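/- Let ω be a strictly positive C^∞-smooth weight on D̄ such that z ↦ log(ω(z)/(1−|z|²)) is subharmonic on D, and let F ∈ A²(D,ω) be holomorphic on D, C^∞ on D̄, and reproduce at 0 for the weight ω. Define Λ_ω(z) = (|F(z)|²/F(0)) · ω(z)/(2(1−|z|²)). Let u be a real-valued C²-smooth subharmonic function on D such that for some β with 0 < β < 1 there is a constant C with |u(z)| ≤ C·(1−|z|)^{−β} for all z ∈ D. Then ∫_D u(z) · 2(1−|z|²) dΣ(z) ≤ ∫_D Λ_ω(z) u(z) · 2(1−|z|²) dΣ(z). -/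

import Mathlib

open Complex MeasureTheory Metric Set

noncomputable section

/-- The open unit disk in ℂ. -/
def unitDisk : Set ℂ := Metric.ball 0 1

/-- The closed unit disk in ℂ. -/
def closedDisk : Set ℂ := Metric.closedBall 0 1

/-- The unit circle in ℂ. -/
def unitCircle : Set ℂ := Metric.sphere 0 1

/-- The normalized area measure dΣ = dx dy / π on ℂ. -/
def dSigma : Measure ℂ := (ENNReal.ofReal (1 / Real.pi)) • (volume : Measure ℂ)

/-- The normalized Laplacian Δ = (1/4)(∂²ₓ + ∂²_y) of a real-valued function on ℂ. -/
def lapR (u : ℂ → ℝ) (z : ℂ) : ℝ :=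
  (1/4) * (fderiv ℝ (fun w => fderiv ℝ u w 1) z 1
    + fderiv ℝ (fun w => fderiv ℝ u w Complex.I) z Complex.I)

/-- The normalized Laplacian Δ = (1/4)(∂²ₓ + ∂²_y) of a complex-valued function on ℂ. -/
def lapC (u : ℂ → ℂ) (z : ℂ) : ℂ :=
  (1/4) * (fderiv ℝ (fun w => fderiv ℝ u w 1) z 1
    + fderiv ℝ (fun w => fderiv ℝ u w Complex.I) z Complex.I)

/-- Membership in the weighted Bergman space A²(𝔻, ω): holomorphic on the unit disk
and square integrable against the weight ω with respect to dΣ. -/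
def MemA2 (ω : ℂ → ℝ) (f : ℂ → ℂ) : Prop :=
  DifferentiableOn ℂ f unitDisk ∧
    IntegrableOn (fun z => ‖f z‖ ^ 2 * ω z) unitDisk dSigma

/-- `k` reproduces at `w` for the weight `ω`. -/
def Reproduces (ω : ℂ → ℝ) (k : ℂ → ℂ) (w : ℂ) : Prop :=
  MemA2 ω k ∧ ∀ f : ℂ → ℂ, MemA2 ω f →
    ∫ z in unitDisk, f z * (starRingEnd ℂ) (k z) * (ω z : ℂ) ∂dSigma = f w

/-- A bounded (complex-valued) harmonic function on the unit disk. -/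
def BoundedHarmonicC (h : ℂ → ℂ) : Prop :=
  ContDiffOn ℝ 2 h unitDisk ∧ (∀ z ∈ unitDisk, lapC h z = 0) ∧
    ∃ M : ℝ, ∀ z ∈ unitDisk, ‖h z‖ ≤ M

/-- A bounded real-valued harmonic function on the unit disk. -/
def BoundedHarmonicR (h : ℂ → ℝ) : Prop :=
  ContDiffOn ℝ 2 h unitDisk ∧ (∀ z ∈ unitDisk, lapR h z = 0) ∧
    ∃ M : ℝ, ∀ z ∈ unitDisk, |h z| ≤ M




/-! ### Second order jets -/

structure Jet (f : ℂ → ℝ) (z : ℂ) (p q L : ℝ) : Prop where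
  cd : ContDiffAt ℝ 2 f z
  dx : fderiv ℝ f z 1 = p
  dy : fderiv ℝ f z Complex.I = q
  lap : lapR f z = L

lemma cd2_diff_fderiv {f : ℂ → ℝ} {z : ℂ} (hf : ContDiffAt ℝ 2 f z) (v : ℂ) :
    DifferentiableAt ℝ (fun w => fderiv ℝ f w v) z := by
  have h1 : ContDiffAt ℝ 1 (fderiv ℝ f) z := hf.fderiv_right (by norm_num)
  exact (h1.differentiableAt (by norm_num)).clm_apply (differentiableAt_const v)

lemma cd2_eventually_diff {f : ℂ → ℝ} {z : ℂ} (hf : ContDiffAt ℝ 2 f z) :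
    ∀ᶠ w in nhds z, DifferentiableAt ℝ f w := by
  have := hf.eventually (by simp)
  filter_upwards [this] with w hw
  exact hw.differentiableAt (by norm_num)

lemma d2_add {f g : ℂ → ℝ} {z : ℂ} (hf : ContDiffAt ℝ 2 f z) (hg : ContDiffAt ℝ 2 g z) (v : ℂ) :
    fderiv ℝ (fun w => fderiv ℝ (fun x => f x + g x) w v) z v =
      fderiv ℝ (fun w => fderiv ℝ f w v) z v + fderiv ℝ (fun w => fderiv ℝ g w v) z v := by
  have : (fun w => fderiv ℝ (fun x => f x + g x) w v) =ᶠ[nhds z]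
      fun w => fderiv ℝ f w v + fderiv ℝ g w v := by
    filter_upwards [cd2_eventually_diff hf, cd2_eventually_diff hg] with w h1 h2
    rw [fderiv_fun_add h1 h2]; rfl
  rw [this.fderiv_eq, fderiv_fun_add (cd2_diff_fderiv hf v) (cd2_diff_fderiv hg v)]; rfl

lemma d2_mul {f g : ℂ → ℝ} {z : ℂ} (hf : ContDiffAt ℝ 2 f z) (hg : ContDiffAt ℝ 2 g z) (v : ℂ) :
    fderiv ℝ (fun w => fderiv ℝ (fun x => f x * g x) w v) z v =
      f z * fderiv ℝ (fun w => fderiv ℝ g w v) z v + g z * fderiv ℝ (fun w => fderiv ℝ f w v) z v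
      + 2 * (fderiv ℝ f z v * fderiv ℝ g z v) := by
  have : (fun w => fderiv ℝ (fun x => f x * g x) w v) =ᶠ[nhds z]
      fun w => f w * fderiv ℝ g w v + g w * fderiv ℝ f w v := by
    filter_upwards [cd2_eventually_diff hf, cd2_eventually_diff hg] with w h1 h2
    rw [fderiv_fun_mul h1 h2]; rfl
  have a1 := hf.differentiableAt (by norm_num : (2 : WithTop ℕ∞) ≠ 0)
  have a2 := hg.differentiableAt (by norm_num : (2 : WithTop ℕ∞) ≠ 0)
  have b1 := cd2_diff_fderiv hf v
  have b2 := cd2_diff_fderiv hg v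
  rw [this.fderiv_eq, fderiv_fun_add (a1.fun_mul b2) (a2.fun_mul b1), fderiv_fun_mul a1 b2,
    fderiv_fun_mul a2 b1]
  simp only [add_apply, smul_apply, smul_eq_mul]
  ring

lemma fderiv_comp_real {h : ℝ → ℝ} {f : ℂ → ℝ} {z : ℂ} (hh : DifferentiableAt ℝ h (f z))
    (hf : DifferentiableAt ℝ f z) (v : ℂ) :
    fderiv ℝ (fun x => h (f x)) z v = deriv h (f z) * fderiv ℝ f z v := by
  have := (hh.hasDerivAt.comp_hasFDerivAt z hf.hasFDerivAt).fderiv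
  have e : (fun x => h (f x)) = h ∘ f := rfl
  rw [e, this]; simp

lemma d2_comp {h : ℝ → ℝ} {f : ℂ → ℝ} {z : ℂ} (hh : ContDiffAt ℝ 2 h (f z))
    (hf : ContDiffAt ℝ 2 f z) (v : ℂ) :
    fderiv ℝ (fun w => fderiv ℝ (fun x => h (f x)) w v) z v =
      deriv h (f z) * fderiv ℝ (fun w => fderiv ℝ f w v) z v
      + deriv (deriv h) (f z) * (fderiv ℝ f z v)^2 := by
  have hh' : ∀ᶠ y in nhds (f z), DifferentiableAt ℝ h y := by
    filter_upwards [hh.eventually (by simp)] with w hw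
    exact hw.differentiableAt (by norm_num)
  have a1 := hf.differentiableAt (by norm_num : (2 : WithTop ℕ∞) ≠ 0)
  have : (fun w => fderiv ℝ (fun x => h (f x)) w v) =ᶠ[nhds z]
      fun w => deriv h (f w) * fderiv ℝ f w v := by
    filter_upwards [cd2_eventually_diff hf, a1.continuousAt.eventually hh'] with w h1 h2
    rw [fderiv_comp_real h2 h1]
  have b1 := cd2_diff_fderiv hf v
  have hd : DifferentiableAt ℝ (deriv h) (f z) := by
    have h1 : ContDiffAt ℝ 1 (fderiv ℝ h) (f z) := hh.fderiv_right (by norm_num)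
    exact (h1.differentiableAt (by norm_num)).clm_apply (differentiableAt_const (1:ℝ))
  have c : DifferentiableAt ℝ (fun w => deriv h (f w)) z := hd.comp z a1
  rw [this.fderiv_eq, fderiv_fun_mul c b1]
  simp only [add_apply, smul_apply, smul_eq_mul,
    fderiv_comp_real hd a1]
  ring

lemma Jet.add {f g : ℂ → ℝ} {z : ℂ} {p q L p' q' L' : ℝ} (hf : Jet f z p q L)
    (hg : Jet g z p' q' L') : Jet (fun x => f x + g x) z (p + p') (q + q') (L + L') := by
  have a1 := hf.cd.differentiableAt (by norm_num : (2 : WithTop ℕ∞) ≠ 0)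
  have a2 := hg.cd.differentiableAt (by norm_num : (2 : WithTop ℕ∞) ≠ 0)
  refine ⟨hf.cd.add hg.cd, ?_, ?_, ?_⟩
  · rw [fderiv_fun_add a1 a2, ← hf.dx, ← hg.dx]; rfl
  · rw [fderiv_fun_add a1 a2, ← hf.dy, ← hg.dy]; rfl
  · rw [← hf.lap, ← hg.lap, lapR, lapR, lapR, d2_add hf.cd hg.cd, d2_add hf.cd hg.cd]; ring

lemma Jet.mul {f g : ℂ → ℝ} {z : ℂ} {p q L p' q' L' : ℝ} (hf : Jet f z p q L)
    (hg : Jet g z p' q' L') : Jet (fun x => f x * g x) z (f z * p' + g z * p)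
      (f z * q' + g z * q) (f z * L' + g z * L + (p * p' + q * q') / 2) := by
  have a1 := hf.cd.differentiableAt (by norm_num : (2 : WithTop ℕ∞) ≠ 0)
  have a2 := hg.cd.differentiableAt (by norm_num : (2 : WithTop ℕ∞) ≠ 0)
  refine ⟨hf.cd.mul hg.cd, ?_, ?_, ?_⟩
  · rw [fderiv_fun_mul a1 a2, ← hf.dx, ← hg.dx]; rfl
  · rw [fderiv_fun_mul a1 a2, ← hf.dy, ← hg.dy]; rfl
  · rw [← hf.lap, ← hg.lap, lapR, lapR, lapR, d2_mul hf.cd hg.cd, d2_mul hf.cd hg.cd,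
      ← hf.dx, ← hg.dx, ← hf.dy, ← hg.dy]; ring

lemma Jet.comp {h : ℝ → ℝ} {f : ℂ → ℝ} {z : ℂ} {p q L : ℝ} (hh : ContDiffAt ℝ 2 h (f z))
    (hf : Jet f z p q L) : Jet (fun x => h (f x)) z (deriv h (f z) * p) (deriv h (f z) * q)
      (deriv h (f z) * L + deriv (deriv h) (f z) * (p ^ 2 + q ^ 2) / 4) := by
  have a1 := hf.cd.differentiableAt (by norm_num : (2 : WithTop ℕ∞) ≠ 0)
  have a2 := hh.differentiableAt (by norm_num : (2 : WithTop ℕ∞) ≠ 0)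
  refine ⟨hh.comp z hf.cd, ?_, ?_, ?_⟩
  · rw [fderiv_comp_real a2 a1, hf.dx]
  · rw [fderiv_comp_real a2 a1, hf.dy]
  · rw [← hf.lap, lapR, lapR, d2_comp hh hf.cd, d2_comp hh hf.cd, ← hf.dx, ← hf.dy]; ring

lemma Jet.const (c : ℝ) (z : ℂ) : Jet (fun _ => c) z 0 0 0 := by
  refine ⟨contDiffAt_const, ?_, ?_, ?_⟩ <;> simp [lapR]

lemma Jet.re (z : ℂ) : Jet (fun x => x.re) z 1 0 0 := by
  have h : ∀ w : ℂ, fderiv ℝ (fun x : ℂ => x.re) w = Complex.reCLM := fun w =>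
    Complex.reCLM.hasFDerivAt.fderiv
  refine ⟨Complex.reCLM.contDiff.contDiffAt, ?_, ?_, ?_⟩ <;> simp [lapR, h]

lemma Jet.im (z : ℂ) : Jet (fun x => x.im) z 0 1 0 := by
  have h : ∀ w : ℂ, fderiv ℝ (fun x : ℂ => x.im) w = Complex.imCLM := fun w =>
    Complex.imCLM.hasFDerivAt.fderiv
  refine ⟨Complex.imCLM.contDiff.contDiffAt, ?_, ?_, ?_⟩ <;> simp [lapR, h]

lemma Jet.congr {f g : ℂ → ℝ} {z : ℂ} {p q L p' q' L' : ℝ} (hf : Jet f z p q L)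
    (h : g =ᶠ[nhds z] f) (hp : p' = p) (hq : q' = q) (hL : L' = L) : Jet g z p' q' L' := by
  subst hp hq hL
  have key : ∀ v : ℂ, (fun w => fderiv ℝ g w v) =ᶠ[nhds z] fun w => fderiv ℝ f w v := by
    intro v
    filter_upwards [h.fderiv (𝕜 := ℝ)] with w hw
    rw [hw]
  refine ⟨hf.cd.congr_of_eventuallyEq h, ?_, ?_, ?_⟩
  · rw [h.fderiv_eq, hf.dx]
  · rw [h.fderiv_eq, hf.dy]
  · rw [← hf.lap, lapR, lapR, (key 1).fderiv_eq, (key Complex.I).fderiv_eq]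

lemma Jet.congr' {f g : ℂ → ℝ} {z : ℂ} {p q L p' q' L' : ℝ} (hf : Jet f z p q L)
    (h : ∀ x, g x = f x) (hp : p' = p) (hq : q' = q) (hL : L' = L) : Jet g z p' q' L' :=
  hf.congr (Filter.Eventually.of_forall h) hp hq hL

lemma lapR_congr {f g : ℂ → ℝ} {z : ℂ} (h : g =ᶠ[nhds z] f) : lapR g z = lapR f z := by
  have key : ∀ v : ℂ, (fun w => fderiv ℝ g w v) =ᶠ[nhds z] fun w => fderiv ℝ f w v := by
    intro v
    filter_upwards [h.fderiv (𝕜 := ℝ)] with w hw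
    rw [hw]
  rw [lapR, lapR, (key 1).fderiv_eq, (key Complex.I).fderiv_eq]

lemma jet_of_cd {f : ℂ → ℝ} {z : ℂ} (h : ContDiffAt ℝ 2 f z) :
    Jet f z (fderiv ℝ f z 1) (fderiv ℝ f z Complex.I) (lapR f z) := ⟨h, rfl, rfl, rfl⟩

lemma lapR_comp_smul (u : ℂ → ℝ) (r : ℝ) (z : ℂ) :
    lapR (fun x => u (r * x)) z = r ^ 2 * lapR u (r * z) := by
  have key : ∀ (g : ℂ → ℝ) (w v : ℂ), fderiv ℝ (fun x : ℂ => g (r * x)) w v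
      = r * fderiv ℝ g (r * w) v := by
    intro g w v
    have := fderiv_comp_smul (𝕜 := ℝ) (f := g) (x := w) r
    have e : (fun x : ℂ => g (r * x)) = (fun x => g (r • x)) := by ext x; simp
    rw [e, this]; simp
  have k2 : ∀ v : ℂ, fderiv ℝ (fun w => fderiv ℝ (fun x : ℂ => u (r * x)) w v) z v
      = r ^ 2 * fderiv ℝ (fun w => fderiv ℝ u w v) (r * z) v := by
    intro v
    have e : (fun w => fderiv ℝ (fun x : ℂ => u (r * x)) w v) =
      fun w => r * (fun w => fderiv ℝ u w v) (r * w) := by ext w; exact key u w v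
    rw [e]
    have e2 : fderiv ℝ (fun w : ℂ => r * (fun w => fderiv ℝ u w v) (r * w)) z
        = r • fderiv ℝ (fun w : ℂ => (fun w => fderiv ℝ u w v) (r * w)) z :=
      congrFun (fderiv_const_smul_field (𝕜 := ℝ) r) z
    rw [e2]
    simp only [smul_apply, smul_eq_mul]
    rw [key (fun w => fderiv ℝ u w v)]; ring
  rw [lapR, lapR, k2, k2]; ring

/-! ### Integration by parts and the fundamental solution -/

instance dSigma_haar : dSigma.IsAddHaarMeasure := by
  unfold dSigma
  refine Measure.IsAddHaarMeasure.smul _ ?_ ENNReal.ofReal_ne_top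
  have : 0 < 1 / Real.pi := by positivity
  simpa using this

lemma dSigma_ball : dSigma.real (ball (0:ℂ) 1) = 1 := by
  simp only [dSigma, Measure.real, Measure.smul_apply, Complex.volume_ball, smul_eq_mul]
  have := Real.pi_pos
  simp only [ENNReal.ofReal_one, one_pow, one_mul, ENNReal.toReal_mul]
  rw [ENNReal.toReal_ofReal (by positivity)]
  have e : ((NNReal.pi : ENNReal)).toReal = Real.pi := rfl
  rw [e]; field_simp

lemma cont_d1 {f : ℂ → ℝ} (hf : ContDiff ℝ 2 f) (v : ℂ) :
    Continuous (fun w => fderiv ℝ f w v) :=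
  (hf.continuous_fderiv (by norm_num)).clm_apply continuous_const

lemma cd_d1 {f : ℂ → ℝ} (hf : ContDiff ℝ 2 f) (v : ℂ) :
    ContDiff ℝ 1 (fun w => fderiv ℝ f w v) :=
  (hf.fderiv_right (by norm_num)).clm_apply contDiff_const

lemma cont_d2 {f : ℂ → ℝ} (hf : ContDiff ℝ 2 f) (v : ℂ) :
    Continuous (fun w => fderiv ℝ (fun x => fderiv ℝ f x v) w v) :=
  ((cd_d1 hf v).continuous_fderiv (by norm_num)).clm_apply continuous_const

lemma cont_lapR {f : ℂ → ℝ} (hf : ContDiff ℝ 2 f) : Continuous (lapR f) := by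
  unfold lapR
  exact continuous_const.mul ((cont_d2 hf 1).add (cont_d2 hf Complex.I))

lemma supp_d1 {f : ℂ → ℝ} (hf : HasCompactSupport f) (v : ℂ) :
    HasCompactSupport (fun w => fderiv ℝ f w v) := hf.fderiv_apply ℝ v

lemma supp_lapR {f : ℂ → ℝ} (hf : HasCompactSupport f) : HasCompactSupport (lapR f) := by
  have := ((supp_d1 (supp_d1 hf 1) 1).add (supp_d1 (supp_d1 hf Complex.I) Complex.I))
  exact this.mul_left (f := fun _ => (1/4 : ℝ))

lemma ibp_dir {V φ : ℂ → ℝ} (hV : ContDiff ℝ 2 V) (hs : HasCompactSupport V)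
    (hφ : ContDiff ℝ 2 φ) (v : ℂ) :
    ∫ x, V x * fderiv ℝ (fun w => fderiv ℝ φ w v) x v ∂dSigma =
      ∫ x, fderiv ℝ (fun w => fderiv ℝ V w v) x v * φ x ∂dSigma := by
  have c1 := cont_d1 hV v
  have c2 := cont_d2 hV v
  have e1 := cont_d1 hφ v
  have e2 := cont_d2 hφ v
  rw [integral_mul_fderiv_eq_neg_fderiv_mul_of_integrable (f := V)
    (g := fun w => fderiv ℝ φ w v) (v := v)]
  · have := integral_mul_fderiv_eq_neg_fderiv_mul_of_integrable (μ := dSigma)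
      (f := fun w => fderiv ℝ V w v) (g := φ) (v := v) ?_ ?_ ?_ ?_ ?_
    · rw [this, neg_neg]
    · exact (c2.mul hφ.continuous).integrable_of_hasCompactSupport
        ((supp_d1 (supp_d1 hs v) v).mul_right)
    · exact (c1.mul e1).integrable_of_hasCompactSupport ((supp_d1 hs v).mul_right)
    · exact (c1.mul hφ.continuous).integrable_of_hasCompactSupport ((supp_d1 hs v).mul_right)
    · intro x _; exact (cd_d1 hV v).differentiable (by norm_num) x
    · intro x _; exact hφ.differentiable (by norm_num) x
  · exact (c1.mul e1).integrable_of_hasCompactSupport ((supp_d1 hs v).mul_right)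
  · exact (hV.continuous.mul e2).integrable_of_hasCompactSupport hs.mul_right
  · exact (hV.continuous.mul e1).integrable_of_hasCompactSupport hs.mul_right
  · intro x _; exact hV.differentiable (by norm_num) x
  · intro x _; exact (cd_d1 hφ v).differentiable (by norm_num) x

lemma ibp {V φ : ℂ → ℝ} (hV : ContDiff ℝ 2 V) (hs : HasCompactSupport V)
    (hφ : ContDiff ℝ 2 φ) :
    ∫ x, V x * lapR φ x ∂dSigma = ∫ x, lapR V x * φ x ∂dSigma := by
  have h1 : ∀ x, V x * lapR φ x = (1/4) * (V x * fderiv ℝ (fun w => fderiv ℝ φ w 1) x 1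
      + V x * fderiv ℝ (fun w => fderiv ℝ φ w Complex.I) x Complex.I) := by
    intro x; unfold lapR; ring
  have h2 : ∀ x, lapR V x * φ x = (1/4) * (fderiv ℝ (fun w => fderiv ℝ V w 1) x 1 * φ x
      + fderiv ℝ (fun w => fderiv ℝ V w Complex.I) x Complex.I * φ x) := by
    intro x; unfold lapR; ring
  simp_rw [h1, h2, integral_const_mul]
  rw [integral_add, integral_add, ibp_dir hV hs hφ, ibp_dir hV hs hφ]
  · exact ((cont_d2 hV 1).mul hφ.continuous).integrable_of_hasCompactSupport
      ((supp_d1 (supp_d1 hs 1) 1).mul_right)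
  · exact ((cont_d2 hV _).mul hφ.continuous).integrable_of_hasCompactSupport
      ((supp_d1 (supp_d1 hs _) _).mul_right)
  · exact (hV.continuous.mul (cont_d2 hφ _)).integrable_of_hasCompactSupport hs.mul_right
  · exact (hV.continuous.mul (cont_d2 hφ _)).integrable_of_hasCompactSupport hs.mul_right

lemma log_integrableOn (R : ℝ) :
    IntegrableOn (fun w : ℂ => Real.log (‖w‖ ^ 2)) (ball 0 R) dSigma := by
  rw [integrableOn_fun_norm_addHaar dSigma (f := fun y => Real.log (y ^ 2))]
  have h : Continuous (fun y : ℝ => 2 * (y * Real.log y)) :=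
    continuous_const.mul Real.continuous_mul_log
  have h2 : IntegrableOn (fun y : ℝ => 2 * (y * Real.log y)) (Ioo 0 R) :=
    (h.continuousOn.integrableOn_Icc).mono_set Ioo_subset_Icc_self
  refine h2.congr_fun (fun y _ => ?_) measurableSet_Ioo
  simp [Complex.finrank_real_complex]
  ring

lemma log_locallyIntegrable : LocallyIntegrable (fun w : ℂ => Real.log (‖w‖ ^ 2)) dSigma := by
  intro x
  refine ⟨ball 0 (‖x‖ + 1), isOpen_ball.mem_nhds (by simp), log_integrableOn _⟩

lemma kernel_facts :
    Integrable (fun v : ℂ => 1 / (‖v‖ ^ 2 + 1) ^ 2) dSigma ∧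
      ∫ v : ℂ, 1 / (‖v‖ ^ 2 + 1) ^ 2 ∂dSigma = 1 := by
  have hd : ∀ y ∈ Ici (0:ℝ), HasDerivAt (fun y : ℝ => -(1/2) * (y ^ 2 + 1)⁻¹)
      (y * (1 / (y ^ 2 + 1) ^ 2)) y := by
    intro y _
    have hne : y ^ 2 + 1 ≠ 0 := by positivity
    have := ((((hasDerivAt_id y).pow 2).add_const 1).inv hne).const_mul (-(1/2))
    refine this.congr_deriv ?_
    simp
    field_simp
  have ht : Filter.Tendsto (fun y : ℝ => -(1/2) * (y ^ 2 + 1)⁻¹) Filter.atTop (nhds 0) := by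
    have : Filter.Tendsto (fun y : ℝ => y ^ 2 + 1) Filter.atTop Filter.atTop :=
      Filter.tendsto_atTop_add_const_right _ _ (Filter.tendsto_pow_atTop (by norm_num))
    simpa [Function.comp_def] using (tendsto_inv_atTop_zero.comp this).const_mul (-(1/2) : ℝ)
  have hpos : ∀ y ∈ Ioi (0:ℝ), 0 ≤ y * (1 / (y ^ 2 + 1) ^ 2) := by
    intro y hy; have : (0:ℝ) < y := hy; positivity
  have hi := integrableOn_Ioi_deriv_of_nonneg' hd hpos ht
  have hv := integral_Ioi_of_hasDerivAt_of_nonneg' hd hpos ht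
  constructor
  · rw [integrable_fun_norm_addHaar dSigma (f := fun y => 1 / (y ^ 2 + 1) ^ 2)]
    simpa [Complex.finrank_real_complex] using hi
  · rw [integral_fun_norm_addHaar dSigma (f := fun y => 1 / (y ^ 2 + 1) ^ 2), dSigma_ball]
    simp only [Complex.finrank_real_complex, smul_eq_mul]
    norm_num at hv ⊢
    rw [hv]; norm_num

lemma normSq_form (z : ℂ) : ‖z‖ ^ 2 = z.re * z.re + z.im * z.im := by
  rw [← Complex.normSq_eq_norm_sq, Complex.normSq_apply]

lemma jet_nsq (z : ℂ) : Jet (fun x => ‖x‖ ^ 2) z (2 * z.re) (2 * z.im) 1 :=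
  (((Jet.re z).mul (Jet.re z)).add ((Jet.im z).mul (Jet.im z))).congr' normSq_form
    (by ring) (by ring) (by ring)

lemma deriv2_log (y : ℝ) : deriv (deriv Real.log) y = -(y ^ 2)⁻¹ := by
  rw [Real.deriv_log']
  simp

lemma jet_logeps {ε : ℝ} (hε : 0 < ε) (z : ℂ) :
    ContDiffAt ℝ 2 (fun x : ℂ => Real.log (‖x‖ ^ 2 + ε)) z ∧
    lapR (fun x : ℂ => Real.log (‖x‖ ^ 2 + ε)) z = ε / (‖z‖ ^ 2 + ε) ^ 2 := by
  have hne : ‖z‖ ^ 2 + ε ≠ 0 := by positivity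
  have := Jet.comp (h := Real.log) (Real.contDiffAt_log.2 hne)
    ((jet_nsq z).add (Jet.const ε z))
  refine ⟨this.cd, ?_⟩
  rw [this.lap, deriv2_log, Real.deriv_log]
  have h2 : (2 * z.re + 0) ^ 2 + (2 * z.im + 0) ^ 2 = 4 * ‖z‖ ^ 2 := by
    rw [normSq_form]; ring
  rw [mul_div_assoc, h2]
  field_simp
  ring

lemma fund_eps {φ : ℂ → ℝ} (hφ : ContDiff ℝ 2 φ) (hs : HasCompactSupport φ) {δ : ℝ} (hδ : 0 < δ) :
    ∫ w, lapR φ w * Real.log (‖w‖ ^ 2 + δ ^ 2) ∂dSigma =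
      ∫ v : ℂ, 1 / (‖v‖ ^ 2 + 1) ^ 2 * φ (δ • v) ∂dSigma := by
  have hL : ContDiff ℝ 2 (fun x : ℂ => Real.log (‖x‖ ^ 2 + δ ^ 2)) :=
    contDiff_iff_contDiffAt.2 fun z => (jet_logeps (by positivity) z).1
  rw [← ibp hφ hs hL]
  have := Measure.integral_comp_smul dSigma
    (fun w : ℂ => φ w * lapR (fun x : ℂ => Real.log (‖x‖ ^ 2 + δ ^ 2)) w) δ
  rw [Complex.finrank_real_complex] at this
  have h2 : ∫ w : ℂ, φ w * lapR (fun x : ℂ => Real.log (‖x‖ ^ 2 + δ ^ 2)) w ∂dSigma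
     = δ ^ 2 * ∫ x : ℂ, φ (δ • x) * lapR (fun x : ℂ => Real.log (‖x‖ ^ 2 + δ ^ 2)) (δ • x) ∂dSigma := by
    rw [this, abs_of_pos (by positivity), smul_eq_mul]
    field_simp
  rw [h2, ← integral_const_mul]
  congr 1; ext v
  rw [(jet_logeps (by positivity) _).2, norm_smul]
  have : ‖δ‖ = δ := by simp [hδ.le]
  rw [this]
  field_simp

lemma fund0 {φ : ℂ → ℝ} (hφ : ContDiff ℝ 2 φ) (hs : HasCompactSupport φ) :
    ∫ w, lapR φ w * Real.log (‖w‖ ^ 2) ∂dSigma = φ 0 := by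
  have hδ0 : Filter.Tendsto (fun n : ℕ => (1 / ((n:ℝ) + 1))) Filter.atTop (nhds 0) :=
    tendsto_one_div_add_atTop_nhds_zero_nat
  have hδ : ∀ n : ℕ, 0 < 1 / ((n:ℝ) + 1) := fun n => by positivity
  have hδ1 : ∀ n : ℕ, 1 / ((n:ℝ) + 1) ≤ 1 := fun n => by
    rw [div_le_one (by positivity)]; linarith [(Nat.cast_nonneg n : (0:ℝ) ≤ n)]
  have hmeas : Measurable (fun w : ℂ => Real.log (‖w‖ ^ 2)) := by fun_prop
  have A : Filter.Tendsto (fun n : ℕ => ∫ w, lapR φ w * Real.log (‖w‖ ^ 2 + (1 / ((n:ℝ) + 1)) ^ 2) ∂dSigma)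
      Filter.atTop (nhds (∫ w, lapR φ w * Real.log (‖w‖ ^ 2) ∂dSigma)) := by
    refine tendsto_integral_of_dominated_convergence
      (fun w => |lapR φ w * Real.log (‖w‖ ^ 2)| + |lapR φ w * Real.log (‖w‖ ^ 2 + 1)|) ?_ ?_ ?_ ?_
    · intro n
      exact ((cont_lapR hφ).measurable.mul (by fun_prop)).aestronglyMeasurable
    · have h1 : Integrable (fun w => lapR φ w * Real.log (‖w‖ ^ 2)) dSigma :=
        log_locallyIntegrable.integrable_smul_left_of_hasCompactSupport (cont_lapR hφ) (supp_lapR hs)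
      have h2 : Integrable (fun w : ℂ => lapR φ w * Real.log (‖w‖ ^ 2 + 1)) dSigma := by
        refine Continuous.integrable_of_hasCompactSupport ((cont_lapR hφ).mul ?_) (supp_lapR hs).mul_right
        exact Continuous.log (by fun_prop) (fun x => by positivity)
      exact h1.abs.add h2.abs
    · intro n
      filter_upwards [compl_mem_ae_iff.2 (measure_singleton (0:ℂ))] with w hw
      have hw0 : 0 < ‖w‖ := norm_pos_iff.2 (by simpa using hw)
      rw [Real.norm_eq_abs, abs_mul, abs_mul, abs_mul, ← mul_add]
      refine mul_le_mul_of_nonneg_left ?_ (abs_nonneg _)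
      have a1 : Real.log (‖w‖ ^ 2) ≤ Real.log (‖w‖ ^ 2 + (1 / ((n:ℝ) + 1)) ^ 2) :=
        Real.log_le_log (by positivity) (by nlinarith [hδ n])
      have a2 : Real.log (‖w‖ ^ 2 + (1 / ((n:ℝ) + 1)) ^ 2) ≤ Real.log (‖w‖ ^ 2 + 1) := by
        have := hδ n
        exact Real.log_le_log (by positivity) (by nlinarith [hδ n, hδ1 n])
      rw [abs_le]
      constructor
      · linarith [neg_abs_le (Real.log (‖w‖ ^ 2)), abs_nonneg (Real.log (‖w‖ ^ 2 + 1))]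
      · linarith [le_abs_self (Real.log (‖w‖ ^ 2 + 1)), abs_nonneg (Real.log (‖w‖ ^ 2))]
    · filter_upwards [compl_mem_ae_iff.2 (measure_singleton (0:ℂ))] with w hw
      have hw0 : 0 < ‖w‖ := norm_pos_iff.2 (by simpa using hw)
      refine Filter.Tendsto.const_mul _ ?_
      refine Filter.Tendsto.log ?_ (by positivity)
      simpa using (hδ0.pow 2).const_add (‖w‖ ^ 2)
  have B : Filter.Tendsto (fun n : ℕ => ∫ v : ℂ, 1 / (‖v‖ ^ 2 + 1) ^ 2 * φ ((1 / ((n:ℝ) + 1)) • v) ∂dSigma)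
      Filter.atTop (nhds (∫ v : ℂ, 1 / (‖v‖ ^ 2 + 1) ^ 2 * φ 0 ∂dSigma)) := by
    obtain ⟨C, hC⟩ := hs.exists_bound_of_continuous hφ.continuous
    refine tendsto_integral_of_dominated_convergence
      (fun v => 1 / (‖v‖ ^ 2 + 1) ^ 2 * C) ?_ ?_ ?_ ?_
    · intro n
      refine Continuous.aestronglyMeasurable ?_
      refine Continuous.mul ?_ (hφ.continuous.comp (by fun_prop))
      exact continuous_const.div (by fun_prop) (fun x => by positivity)
    · exact kernel_facts.1.mul_const C
    · intro n
      refine Filter.Eventually.of_forall fun v => ?_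
      rw [norm_mul, Real.norm_of_nonneg (by positivity)]
      exact mul_le_mul_of_nonneg_left (hC _) (by positivity)
    · refine Filter.Eventually.of_forall fun v => ?_
      refine Filter.Tendsto.const_mul _ ?_
      have := (hφ.continuous.tendsto 0)
      refine this.comp ?_
      simpa using hδ0.smul_const v
  have e : (fun n : ℕ => ∫ w, lapR φ w * Real.log (‖w‖ ^ 2 + (1 / ((n:ℝ) + 1)) ^ 2) ∂dSigma) =
      fun n : ℕ => ∫ v : ℂ, 1 / (‖v‖ ^ 2 + 1) ^ 2 * φ ((1 / ((n:ℝ) + 1)) • v) ∂dSigma := by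
    ext n; exact fund_eps hφ hs (hδ n)
  rw [e] at A
  rw [tendsto_nhds_unique A B, integral_mul_const, kernel_facts.2, one_mul]

lemma fund {φ : ℂ → ℝ} (hφ : ContDiff ℝ 2 φ) (hs : HasCompactSupport φ) (z : ℂ) :
    ∫ w, lapR φ w * Real.log (‖z - w‖ ^ 2) ∂dSigma = φ z := by
  have h1 : ContDiff ℝ 2 (fun x => φ (x + z)) := hφ.comp (contDiff_id.add contDiff_const)
  have h2 : HasCompactSupport (fun x => φ (x + z)) :=
    hs.comp_homeomorph (Homeomorph.addRight z)
  have := fund0 h1 h2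
  simp only [zero_add] at this
  rw [← this, ← integral_add_right_eq_self (μ := dSigma) _ z]
  congr 1; ext w
  have e : z - (w + z) = -w := by ring
  rw [e, norm_neg]
  congr 1
  have key : ∀ (g : ℂ → ℝ) (x v : ℂ), fderiv ℝ (fun x : ℂ => g (x + z)) x v
      = fderiv ℝ g (x + z) v := by
    intro g x v; rw [fderiv_comp_add_right]
  have k2 : ∀ v : ℂ, (fun x => fderiv ℝ (fun x : ℂ => φ (x + z)) x v) =
      fun x => (fun y => fderiv ℝ φ y v) (x + z) := fun v => funext fun x => key φ x v
  rw [lapR, lapR, k2, k2, key (fun y => fderiv ℝ φ y 1), key (fun y => fderiv ℝ φ y Complex.I)]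

/-! ### The truncated Green functions -/

def tau (z : ℂ) : ℝ := 1 - ‖z‖ ^ 2
def dd (w z : ℂ) : ℝ := 1 - 2 * (w.re * z.re + w.im * z.im) + ‖w‖ ^ 2 * ‖z‖ ^ 2
def ss (w z : ℂ) : ℝ := tau w * tau z * (dd w z)⁻¹
def MM (w z : ℂ) : ℝ := 4 - ‖z‖ ^ 2 - ‖w‖ ^ 2 - 2 * (w.re * z.re + w.im * z.im)
def SN (N : ℕ) (s : ℝ) : ℝ := ∑ k ∈ Finset.range N, s ^ (k + 1) / (k + 1)
def kn (n : ℕ) (s : ℝ) : ℝ :=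
  ∑ j ∈ Finset.range n, s ^ j / ((j + 3) * (j + 2)) + s ^ n / (n + 2)
def hN (N : ℕ) (s : ℝ) : ℝ := -(1 - s) * SN N s + s - s ^ 2 / 2
def HH (w z : ℂ) : ℝ :=
  -tau w * (2 * (1 - (w.re * z.re + w.im * z.im)) / dd w z - 1
    + tau w / 2 * (2 * ((1 - (w.re * z.re + w.im * z.im)) ^ 2
        - (w.re * z.im - w.im * z.re) ^ 2) / dd w z ^ 2 - 1))
def dx1 (w z : ℂ) : ℝ := -2 * w.re + 2 * ‖w‖ ^ 2 * z.re
def dy1 (w z : ℂ) : ℝ := -2 * w.im + 2 * ‖w‖ ^ 2 * z.im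
def sx1 (w z : ℂ) : ℝ := tau w * (-2 * z.re / dd w z - tau z * dx1 w z / dd w z ^ 2)
def sy1 (w z : ℂ) : ℝ := tau w * (-2 * z.im / dd w z - tau z * dy1 w z / dd w z ^ 2)
def gg (w z : ℂ) : ℝ :=
  ((dd w z * (-2 * z.re - 2 * w.re) + MM w z * dx1 w z) * sx1 w z
    + (dd w z * (-2 * z.im - 2 * w.im) + MM w z * dy1 w z) * sy1 w z) / 2
def bv (w z : ℂ) : ℝ := MM w z * tau w ^ 2 / dd w z / 4
def av (w z : ℂ) : ℝ := gg w z / 4 - 2 * bv w z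
def Gam (n : ℕ) (w z : ℂ) : ℝ :=
  (max (tau z) 0) ^ 3 * (tau w ^ 3 * ((dd w z)⁻¹ ^ 2) / 8 * (dd w z + 2 * MM w z * kn n (ss w z)))
def EE (w z : ℂ) : ℝ := Real.log (1 - ss w z) - HH w z

lemma kn_hN (n : ℕ) (s : ℝ) : s ^ 3 * kn n s = hN (n + 2) s := by
  unfold kn hN SN
  induction n with
  | zero => simp [Finset.sum_range_succ]; ring
  | succ n ih =>
    rw [Finset.sum_range_succ] at ih ⊢
    rw [Finset.sum_range_succ _ (n+2)]
    have h2 : (n:ℝ) + 2 ≠ 0 := by positivity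
    have h3 : (n:ℝ) + 3 ≠ 0 := by positivity
    have h4 : (n:ℝ) + 2 + 1 ≠ 0 := by positivity
    have h5 : (n:ℝ) + 1 + 2 ≠ 0 := by positivity
    push_cast at ih ⊢
    rw [Finset.sum_range_succ] at ih
    rw [Finset.sum_range_succ _ (n+1),
      Finset.sum_range_succ (fun x : ℕ => s ^ (x + 1) / ((x:ℝ) + 1)) n]
    push_cast at ih ⊢
    have key : s ^ 3 * (s ^ n / (((n:ℝ) + 3) * (n + 2)) + s ^ (n + 1) / (n + 1 + 2)
       - s ^ n / (n + 2)) = -(1 - s) * (s ^ (n + 2 + 1) / (n + 2 + 1)) := by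
      field_simp; ring
    linear_combination ih + key

lemma kn_nonneg (n : ℕ) {s : ℝ} (hs : 0 ≤ s) : 0 ≤ kn n s := by
  unfold kn; positivity

lemma dd_eq (w z : ℂ) : dd w z = ‖1 - (starRingEnd ℂ) w * z‖ ^ 2 := by
  rw [dd, normSq_form, normSq_form, normSq_form]; simp; ring

lemma MM_eq (w z : ℂ) : MM w z = 4 - ‖z + w‖ ^ 2 := by
  rw [MM, normSq_form, normSq_form, normSq_form]; simp; ring

lemma dd_pos {w z : ℂ} (hw : ‖w‖ < 1) (hz : ‖z‖ ≤ 1) : 0 < dd w z := by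
  rw [dd_eq]
  have : 1 - (starRingEnd ℂ) w * z ≠ 0 := by
    intro h
    have h1 : ‖(starRingEnd ℂ) w * z‖ = 1 := by rw [← sub_eq_zero.1 h]; simp
    rw [norm_mul, RCLike.norm_conj] at h1
    nlinarith [norm_nonneg w, norm_nonneg z]
  positivity

lemma tau_pos {z : ℂ} (hz : ‖z‖ < 1) : 0 < tau z := by
  unfold tau; nlinarith [norm_nonneg z]

lemma MM_nonneg {w z : ℂ} (hw : ‖w‖ < 1) (hz : ‖z‖ ≤ 1) : 0 ≤ MM w z := by
  rw [MM_eq]; nlinarith [norm_add_le z w, norm_nonneg (z + w)]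

lemma one_sub_ss {w z : ℂ} (hw : ‖w‖ < 1) (hz : ‖z‖ ≤ 1) :
    1 - ss w z = ‖z - w‖ ^ 2 / dd w z := by
  have := (dd_pos hw hz).ne'
  rw [ss, eq_div_iff this, sub_mul, mul_assoc, inv_mul_cancel₀ this, dd, tau, tau,
    normSq_form, normSq_form, normSq_form]
  simp; ring

lemma ss_nonneg {w z : ℂ} (hw : ‖w‖ < 1) (hz : ‖z‖ < 1) : 0 ≤ ss w z := by
  have := (dd_pos hw hz.le)
  have := tau_pos hz
  have := tau_pos hw
  unfold ss; positivity

lemma ss_le_one {w z : ℂ} (hw : ‖w‖ < 1) (hz : ‖z‖ < 1) : ss w z ≤ 1 := by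
  have := (dd_pos hw hz.le)
  have h := one_sub_ss hw hz.le
  have : 0 ≤ ‖z - w‖ ^ 2 / dd w z := by positivity
  linarith

lemma ss_lt_one {w z : ℂ} (hw : ‖w‖ < 1) (hz : ‖z‖ < 1) (hzw : z ≠ w) : ss w z < 1 := by
  have := (dd_pos hw hz.le)
  have h := one_sub_ss hw hz.le
  have h0 : 0 < ‖z - w‖ := norm_pos_iff.2 (sub_ne_zero.2 hzw)
  have : 0 < ‖z - w‖ ^ 2 / dd w z := by positivity
  linarith

lemma Gam_nonneg (n : ℕ) {w : ℂ} (hw : ‖w‖ < 1) (z : ℂ) : 0 ≤ Gam n w z := by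
  unfold Gam
  by_cases hz : ‖z‖ < 1
  · have := (dd_pos hw hz.le)
    have := tau_pos hw
    have := MM_nonneg hw hz.le
    have := kn_nonneg n (ss_nonneg hw hz)
    positivity
  · have : max (tau z) 0 = 0 := max_eq_right (by unfold tau; nlinarith)
    simp [this]

lemma Gam_zero (n : ℕ) (w : ℂ) {z : ℂ} (hz : 1 ≤ ‖z‖) : Gam n w z = 0 := by
  have : max (tau z) 0 = 0 := max_eq_right (by unfold tau; nlinarith)
  simp [Gam, this]

lemma Gam_supp (n : ℕ) (w : ℂ) : HasCompactSupport (Gam n w) := by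
  refine HasCompactSupport.intro (isCompact_closedBall (0:ℂ) 1) fun z hz => ?_
  refine Gam_zero n w ?_
  simp at hz; exact hz.le

lemma cube_pos_part : ContDiff ℝ 2 (fun x : ℝ => (max x 0) ^ 3) := by
  have hk : ∀ (m : ℕ) (x : ℝ), HasDerivAt (fun x : ℝ => (max x 0) ^ (m + 2))
      ((m + 2) * (max x 0) ^ (m + 1)) x := by
    intro m x
    rcases lt_trichotomy x 0 with h | h | h
    · have e : (fun x : ℝ => (max x 0) ^ (m + 2)) =ᶠ[nhds x] fun _ => 0 := by
        filter_upwards [Iio_mem_nhds h] with y hy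
        rw [max_eq_right (le_of_lt hy)]; simp
      rw [max_eq_right h.le]
      simpa using (hasDerivAt_const x (0:ℝ)).congr_of_eventuallyEq e
    · subst h
      simp only [max_self]
      rw [hasDerivAt_iff_isLittleO_nhds_zero]
      simp only [zero_add, max_self, ne_eq, Nat.add_eq_zero_iff, OfNat.ofNat_ne_zero, and_false,
        not_false_eq_true, zero_pow, sub_zero, one_ne_zero, mul_zero, smul_eq_mul]
      have h1 : (fun x : ℝ => (max x 0) ^ (m + 2)) =O[nhds 0] fun x : ℝ => x ^ (m+2) := by
        refine Asymptotics.IsBigO.of_bound 1 (Filter.Eventually.of_forall fun x => ?_)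
        rw [norm_pow, norm_pow, one_mul]
        gcongr
        rw [Real.norm_eq_abs, abs_of_nonneg (le_max_right _ _), Real.norm_eq_abs]
        exact max_le (le_abs_self x) (abs_nonneg x)
      have h2 := (Asymptotics.isLittleO_pow_id (𝕜 := ℝ) (show 1 < m + 2 by omega))
      simpa using h1.trans_isLittleO h2
    · have e : (fun x : ℝ => (max x 0) ^ (m + 2)) =ᶠ[nhds x] fun y => y ^ (m + 2) := by
        filter_upwards [Ioi_mem_nhds h] with y hy
        rw [max_eq_left (le_of_lt hy)]
      rw [max_eq_left h.le]
      have := (hasDerivAt_pow (m+2) x).congr_of_eventuallyEq e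
      simpa using this
  have h1 : ContDiff ℝ 1 (fun x : ℝ => (max x 0) ^ 2) := by
    rw [contDiff_one_iff_deriv]
    refine ⟨fun x => (hk 0 x).differentiableAt, ?_⟩
    have : deriv (fun x : ℝ => (max x 0) ^ 2) = fun x => 2 * max x 0 := by
      ext x; rw [(hk 0 x).deriv]; simp
    rw [this]; fun_prop
  have : ContDiff ℝ (1 + 1) (fun x : ℝ => (max x 0) ^ 3) := by
    rw [contDiff_succ_iff_deriv]
    refine ⟨fun x => (hk 1 x).differentiableAt, by simp, ?_⟩
    have : deriv (fun x : ℝ => (max x 0) ^ 3) = fun x => 3 * (max x 0) ^ 2 := by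
      ext x; rw [(hk 1 x).deriv]; norm_num
    rw [this]
    exact contDiff_const.mul h1
  convert this using 1
  norm_num

lemma cd_nsq : ContDiff ℝ 2 (fun x : ℂ => ‖x‖ ^ 2) :=
  contDiff_iff_contDiffAt.2 fun z => (jet_nsq z).cd

lemma cd_re : ContDiff ℝ 2 (fun x : ℂ => x.re) := Complex.reCLM.contDiff
lemma cd_im : ContDiff ℝ 2 (fun x : ℂ => x.im) := Complex.imCLM.contDiff

lemma cd_dd (w : ℂ) : ContDiff ℝ 2 (dd w) := by
  unfold dd
  exact (contDiff_const.sub (contDiff_const.mul ((contDiff_const.mul cd_re).add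
    (contDiff_const.mul cd_im)))).add (contDiff_const.mul cd_nsq)

lemma cd_MM (w : ℂ) : ContDiff ℝ 2 (MM w) := by
  unfold MM
  exact ((contDiff_const.sub cd_nsq).sub contDiff_const).sub
    (contDiff_const.mul ((contDiff_const.mul cd_re).add (contDiff_const.mul cd_im)))

lemma cd_tau : ContDiff ℝ 2 tau := contDiff_const.sub cd_nsq

lemma cd_ss {w z : ℂ} (h : dd w z ≠ 0) : ContDiffAt ℝ 2 (ss w) z := by
  unfold ss
  exact (contDiffAt_const.mul cd_tau.contDiffAt).mul ((cd_dd w).contDiffAt.inv h)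

lemma cd_kn (n : ℕ) : ContDiff ℝ 2 (kn n) := by
  unfold kn
  fun_prop

lemma Gam_cd (n : ℕ) {w : ℂ} (hw : ‖w‖ < 1) : ContDiff ℝ 2 (Gam n w) := by
  rw [contDiff_iff_contDiffAt]
  intro z
  by_cases hz : ‖z‖ ≤ 1
  · have hd := (dd_pos hw hz).ne'
    unfold Gam
    refine ContDiffAt.mul ?_ ?_
    · exact (cube_pos_part.comp cd_tau).contDiffAt
    · refine ContDiffAt.mul ?_ ?_
      · exact (contDiffAt_const.mul (((cd_dd w).contDiffAt.inv hd).pow 2)).div_const _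
      · refine (cd_dd w).contDiffAt.add ((contDiffAt_const.mul (cd_MM w).contDiffAt).mul ?_)
        exact (cd_kn n).contDiffAt.comp z (cd_ss hd)
  · have : Gam n w =ᶠ[nhds z] fun _ => 0 := by
      have : {x : ℂ | 1 < ‖x‖} ∈ nhds z :=
        (isOpen_lt continuous_const continuous_norm).mem_nhds (not_le.1 hz)
      filter_upwards [this] with x hx
      exact Gam_zero n w (le_of_lt hx)
    exact contDiffAt_const.congr_of_eventuallyEq this

lemma Gam_lap_out (n : ℕ) {w z : ℂ} (hz : 1 < ‖z‖) : lapR (Gam n w) z = 0 := by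
  have : Gam n w =ᶠ[nhds z] fun _ => 0 := by
    have : {x : ℂ | 1 < ‖x‖} ∈ nhds z :=
      (isOpen_lt continuous_const continuous_norm).mem_nhds hz
    filter_upwards [this] with x hx
    exact Gam_zero n w (le_of_lt hx)
  rw [lapR_congr this, (Jet.const 0 z).lap]


lemma SN_deriv (N : ℕ) (s : ℝ) :
    HasDerivAt (SN N) (∑ k ∈ Finset.range N, s ^ k) s := by
  unfold SN
  refine HasDerivAt.fun_sum fun k _ => ?_
  have := (hasDerivAt_pow (k + 1) s).div_const ((k:ℝ) + 1)
  refine this.congr_deriv ?_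
  have : (k:ℝ) + 1 ≠ 0 := by positivity
  simp only [Nat.cast_add, Nat.cast_one, Nat.add_sub_cancel]
  field_simp

lemma hN_deriv (N : ℕ) (s : ℝ) : HasDerivAt (hN N) (SN N s + s ^ N - s) s := by
  unfold hN
  have h1 : HasDerivAt (fun s : ℝ => -(1 - s)) 1 s := by
    have := (hasDerivAt_id' s).sub_const 1
    exact this.congr_of_eventuallyEq (.of_forall fun x => by ring)
  have := (((h1.mul (SN_deriv N s)).add (hasDerivAt_id s)).sub
    ((hasDerivAt_pow 2 s).div_const 2))
  refine this.congr_deriv ?_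
  have g := mul_neg_geom_sum s N
  simp only [Nat.cast_ofNat, Nat.add_one_sub_one, pow_one]
  linear_combination -g

lemma hN_deriv2 (N : ℕ) (s : ℝ) :
    HasDerivAt (deriv (hN N)) (∑ k ∈ Finset.range N, s ^ k + N * s ^ (N - 1) - 1) s := by
  have e : deriv (hN N) = fun s => SN N s + s ^ N - s := by
    ext s; exact (hN_deriv N s).deriv
  rw [e]
  exact ((SN_deriv N s).add (hasDerivAt_pow N s)).sub (hasDerivAt_id s)

lemma hN_cd (N : ℕ) : ContDiff ℝ 2 (hN N) := by
  unfold hN SN; fun_prop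

lemma jet_tau (z : ℂ) : Jet tau z (-2 * z.re) (-2 * z.im) (-1) :=
  ((Jet.const 1 z).add ((Jet.const (-1) z).mul (jet_nsq z))).congr'
    (fun x => by simp only [tau]; ring) (by ring) (by ring) (by ring)

lemma jet_lin (w z : ℂ) : Jet (fun x => w.re * x.re + w.im * x.im) z w.re w.im 0 :=
  (((Jet.const w.re z).mul (Jet.re z)).add ((Jet.const w.im z).mul (Jet.im z))).congr'
    (fun x => rfl) (by ring) (by ring) (by ring)

lemma jet_dd (w z : ℂ) : Jet (dd w) z (dx1 w z) (dy1 w z) (‖w‖ ^ 2) :=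
  (((Jet.const 1 z).add ((Jet.const (-2) z).mul (jet_lin w z))).add
    ((Jet.const (‖w‖ ^ 2) z).mul (jet_nsq z))).congr'
    (fun x => by simp only [dd]; ring) (by simp only [dx1]; ring) (by simp only [dy1]; ring)
    (by ring)

lemma jet_MM (w z : ℂ) : Jet (MM w) z (-2 * z.re - 2 * w.re) (-2 * z.im - 2 * w.im) (-1) :=
  (((Jet.const (4 - ‖w‖ ^ 2) z).add ((Jet.const (-1) z).mul (jet_nsq z))).add
    ((Jet.const (-2) z).mul (jet_lin w z))).congr'
    (fun x => by simp only [MM]; ring) (by ring) (by ring) (by ring)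

lemma deriv2_inv {y : ℝ} (hy : y ≠ 0) : deriv (deriv (fun x : ℝ => x⁻¹)) y = 2 * (y ^ 3)⁻¹ := by
  have e : deriv (fun x : ℝ => x⁻¹) = fun x => -(x ^ 2)⁻¹ := by ext x; simp
  rw [e]
  have : HasDerivAt (fun x : ℝ => -(x ^ 2)⁻¹) _ y :=
    ((hasDerivAt_pow 2 y).inv (pow_ne_zero 2 hy)).neg
  rw [HasDerivAt.deriv this]
  simp only [Nat.cast_ofNat, Nat.add_one_sub_one, pow_one]
  field_simp

lemma grad_dd (w z : ℂ) : dx1 w z ^ 2 + dy1 w z ^ 2 = 4 * ‖w‖ ^ 2 * dd w z := by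
  simp only [dx1, dy1, dd, normSq_form]; ring

lemma jet_ddinv {w z : ℂ} (h : dd w z ≠ 0) :
    Jet (fun x => (dd w x)⁻¹) z (-dx1 w z / dd w z ^ 2) (-dy1 w z / dd w z ^ 2)
      (‖w‖ ^ 2 / dd w z ^ 2) := by
  have h1 : ContDiffAt ℝ 2 (fun x : ℝ => x⁻¹) (dd w z) := contDiffAt_inv ℝ h
  refine (Jet.comp h1 (jet_dd w z)).congr' (fun x => rfl) ?_ ?_ ?_
  · simp; ring
  · simp; ring
  · rw [grad_dd, deriv2_inv h]; simp; field_simp; ring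

lemma jet_ss {w z : ℂ} (h : dd w z ≠ 0) :
    Jet (ss w) z (sx1 w z) (sy1 w z) (-(tau w) ^ 2 / dd w z ^ 2) := by
  refine (((Jet.const (tau w) z).mul (jet_tau z)).mul (jet_ddinv h)).congr' (fun x => rfl) ?_ ?_ ?_
  · simp only [sx1]; field_simp; ring
  · simp only [sy1]; field_simp; ring
  · field_simp
    simp only [tau, dx1, dy1, dd, normSq_form]; ring

lemma grad_ss {w z : ℂ} (h : dd w z ≠ 0) :
    sx1 w z ^ 2 + sy1 w z ^ 2 = 4 * (tau w ^ 2 * (1 - ss w z) / dd w z ^ 2) := by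
  simp only [sx1, sy1, ss]
  field_simp
  simp only [tau, dx1, dy1, dd, normSq_form]; ring

/-- Laplacian of `dd * MM`. -/
def XX (w z : ℂ) : ℝ := -dd w z + MM w z * ‖w‖ ^ 2
  + (dx1 w z * (-2 * z.re - 2 * w.re) + dy1 w z * (-2 * z.im - 2 * w.im)) / 2

lemma jet_dM (w z : ℂ) : Jet (fun x => dd w x * MM w x) z
    (dd w z * (-2 * z.re - 2 * w.re) + MM w z * dx1 w z)
    (dd w z * (-2 * z.im - 2 * w.im) + MM w z * dy1 w z) (XX w z) :=
  ((jet_dd w z).mul (jet_MM w z)).congr' (fun x => rfl) rfl rfl (by simp only [XX]; ring)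

lemma ident1 {w z : ℂ} (h : dd w z ≠ 0) :
    (-(1 - ss w z) * XX w z + gg w z - MM w z * tau w ^ 2 / dd w z) / 4 = - tau z := by
  simp only [gg, sx1, sy1, ss, XX]
  field_simp
  simp only [tau, dx1, dy1, dd, MM, normSq_form]; ring

/-- Laplacian of `tau ^ 2 * ss`. -/
def YY (w z : ℂ) : ℝ := tau z ^ 2 * (-(tau w) ^ 2 / dd w z ^ 2)
  + ss w z * (-2 * tau z + 2 * ‖z‖ ^ 2)
  - 2 * tau z * (z.re * sx1 w z + z.im * sy1 w z)

lemma jet_tts {w z : ℂ} (h : dd w z ≠ 0) : Jet (fun x => tau x * tau x * ss w x) z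
    (tau z * tau z * sx1 w z + ss w z * (tau z * (-2 * z.re) + tau z * (-2 * z.re)))
    (tau z * tau z * sy1 w z + ss w z * (tau z * (-2 * z.im) + tau z * (-2 * z.im))) (YY w z) :=
  (((jet_tau z).mul (jet_tau z)).mul (jet_ss h)).congr' (fun x => rfl) rfl rfl
    (by simp only [YY]; rw [normSq_form z]; ring)

lemma ident2 {w z : ℂ} (h : dd w z ≠ 0) :
    tau w ^ 2 * YY w z / 8 + (XX w z * (ss w z - ss w z ^ 2 / 2) - gg w z * ss w z
      + 2 * ss w z * (MM w z * tau w ^ 2 / dd w z)) / 4 = - tau z * HH w z := by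
  simp only [gg, sx1, sy1, ss, XX, YY, HH]
  field_simp
  simp only [tau, dx1, dy1, dd, MM, normSq_form]; ring

lemma Gam_lap_in (n : ℕ) {w z : ℂ} (hw : ‖w‖ < 1) (hz : ‖z‖ < 1) :
    lapR (Gam n w) z = tau z * (-SN (n + 2) (ss w z) - HH w z) + ss w z ^ (n + 2) * av w z
      + (n + 2 : ℕ) * ss w z ^ (n + 1) * (1 - ss w z) * bv w z := by
  have hd := (dd_pos hw hz.le).ne'
  have e : Gam n w =ᶠ[nhds z] fun x => 1 / 8 * (tau w ^ 2 * (tau x * tau x * ss w x)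
      + 2 * ((dd w x * MM w x) * hN (n + 2) (ss w x))) := by
    have : ball (0:ℂ) 1 ∈ nhds z := isOpen_ball.mem_nhds (by simpa using hz)
    filter_upwards [this] with x hx
    have hx : ‖x‖ < 1 := by simpa using hx
    have hd := (dd_pos hw hx.le).ne'
    rw [Gam, max_eq_left (tau_pos hx).le, ← kn_hN]
    have : tau w * tau x = ss w x * dd w x := by rw [ss]; field_simp
    have h3 : (dd w x)⁻¹ * dd w x = 1 := inv_mul_cancel₀ hd
    simp only [ss]
    generalize kn n (tau w * tau x * (dd w x)⁻¹) = K
    field_simp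
    try ring
  rw [lapR_congr e]
  have J := (Jet.const (1/8) z).mul (((Jet.const (tau w ^ 2) z).mul (jet_tts hd)).add
    ((Jet.const 2 z).mul ((jet_dM w z).mul (Jet.comp (hN_cd (n + 2)).contDiffAt (jet_ss hd)))))
  rw [J.lap, (hN_deriv (n + 2) _).deriv, (hN_deriv2 (n + 2) _).deriv, mul_div_assoc,
    grad_ss hd]
  have i1 := ident1 hd
  have i2 := ident2 hd
  have g := mul_neg_geom_sum (ss w z) (n + 2)
  simp only [av, bv]
  have hn : n + 2 - 1 = n + 1 := rfl
  rw [hn]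
  have hg : gg w z = ((dd w z * (-2 * z.re - 2 * w.re) + MM w z * dx1 w z) * sx1 w z
    + (dd w z * (-2 * z.im - 2 * w.im) + MM w z * dy1 w z) * sy1 w z) / 2 := rfl
  have hq : dd w z * MM w z * (tau w ^ 2 / dd w z ^ 2) = MM w z * tau w ^ 2 / dd w z := by
    field_simp
  simp only [hN]
  generalize MM w z * tau w ^ 2 / dd w z = q at *
  have hq' : dd w z * MM w z * (-tau w ^ 2 / dd w z ^ 2) = - q := by rw [← hq]; ring
  generalize ss w z = s at *
  generalize SN (n + 2) s = S at *
  generalize (∑ i ∈ Finset.range (n + 2), s ^ i) = G at *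
  generalize gg w z = g2 at *
  have hq2 : dd w z * MM w z * ((tau w ^ 2 * (1 - s)) / dd w z ^ 2) = q * (1 - s) := by
    rw [← hq]; ring
  generalize (tau w ^ 2 * (1 - s)) / dd w z ^ 2 = r2 at *
  generalize (-tau w ^ 2) / dd w z ^ 2 = r1 at *
  linear_combination S * i1 + i2 + (1/4) * (S + s ^ (n+2) - s) * hq'
    + (1/4) * (G + (n+2:ℕ) * s ^ (n+1) - 1) * hq2 + q / 4 * g - (1/4) * (S + s ^ (n+2) - s) * hg


lemma log_shift_int (w : ℂ) (R : ℝ) :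
    IntegrableOn (fun z : ℂ => Real.log (‖z - w‖ ^ 2)) (ball 0 R) dSigma := by
  have h := log_locallyIntegrable
  have h1 : IntegrableOn (fun w : ℂ => Real.log (‖w‖ ^ 2)) (ball 0 (R + ‖w‖)) dSigma :=
    log_integrableOn _
  rw [← integrable_indicator_iff measurableSet_ball] at h1
  have h2 := h1.comp_sub_right w
  refine (h2.integrableOn (s := ball 0 R)).congr_fun ?_ measurableSet_ball
  intro z hz
  have hz : ‖z‖ < R := by simpa using hz
  have : z - w ∈ ball (0:ℂ) (R + ‖w‖) := by
    simp only [mem_ball, dist_zero_right]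
    linarith [norm_sub_le z w]
  simp only [indicator_of_mem this]

lemma meas_tau : Measurable tau := by unfold tau; fun_prop
lemma meas_dd (w : ℂ) : Measurable (dd w) := by unfold dd; fun_prop
lemma meas_ss (w : ℂ) : Measurable (ss w) := by
  unfold ss; exact (measurable_const.mul meas_tau).mul (meas_dd w).inv
lemma meas_HH (w : ℂ) : Measurable (HH w) := by
  have := meas_dd w
  unfold HH; fun_prop
lemma meas_EE (w : ℂ) : Measurable (EE w) := by
  have := meas_ss w
  have := meas_HH w
  unfold EE; fun_prop

lemma cont_dd (w : ℂ) : Continuous (dd w) := (cd_dd w).continuous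

lemma cont_HH {w : ℂ} (hw : ‖w‖ < 1) : ContinuousOn (HH w) (closedBall 0 1) := by
  have h : ∀ z ∈ closedBall (0:ℂ) 1, dd w z ≠ 0 := fun z hz => (dd_pos hw (by simpa using hz)).ne'
  have h2 : ∀ z ∈ closedBall (0:ℂ) 1, dd w z ^ 2 ≠ 0 := fun z hz => pow_ne_zero 2 (h z hz)
  have := (cont_dd w).continuousOn (s := closedBall 0 1)
  unfold HH
  fun_prop (disch := assumption)

lemma cont_bv {w : ℂ} (hw : ‖w‖ < 1) : ContinuousOn (bv w) (closedBall 0 1) := by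
  have h : ∀ z ∈ closedBall (0:ℂ) 1, dd w z ≠ 0 := fun z hz => (dd_pos hw (by simpa using hz)).ne'
  have := (cont_dd w).continuousOn (s := closedBall 0 1)
  have := (cd_MM w).continuous.continuousOn (s := closedBall 0 1)
  unfold bv
  fun_prop (disch := assumption)

lemma cont_gg {w : ℂ} (hw : ‖w‖ < 1) : ContinuousOn (gg w) (closedBall 0 1) := by
  have h : ∀ z ∈ closedBall (0:ℂ) 1, dd w z ≠ 0 := fun z hz => (dd_pos hw (by simpa using hz)).ne'
  have h2 : ∀ z ∈ closedBall (0:ℂ) 1, dd w z ^ 2 ≠ 0 := fun z hz => pow_ne_zero 2 (h z hz)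
  have := (cont_dd w).continuousOn (s := closedBall 0 1)
  have := (cd_MM w).continuous.continuousOn (s := closedBall 0 1)
  have := cd_tau.continuous.continuousOn (s := closedBall 0 1)
  unfold gg sx1 sy1 dx1 dy1
  fun_prop (disch := assumption)

lemma cont_av {w : ℂ} (hw : ‖w‖ < 1) : ContinuousOn (av w) (closedBall 0 1) := by
  unfold av
  exact ((cont_gg hw).div_const 4).sub (continuousOn_const.mul (cont_bv hw))

lemma bdd_of_cont {f : ℂ → ℝ} (hf : ContinuousOn f (closedBall 0 1)) :
    ∃ B, 0 ≤ B ∧ ∀ z, ‖z‖ ≤ 1 → |f z| ≤ B := by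
  obtain ⟨B, hB⟩ := (isCompact_closedBall (0:ℂ) 1).exists_bound_of_continuousOn hf
  refine ⟨B, (norm_nonneg _).trans (hB 0 (by simp)), fun z hz => hB z (by simpa using hz)⟩

lemma log_one_sub_ss {w z : ℂ} (hw : ‖w‖ < 1) (hz : ‖z‖ ≤ 1) (h : z ≠ w) :
    Real.log (1 - ss w z) = Real.log (‖z - w‖ ^ 2) - Real.log (dd w z) := by
  rw [one_sub_ss hw hz, Real.log_div _ (dd_pos hw hz).ne']
  exact pow_ne_zero 2 (norm_ne_zero_iff.2 (sub_ne_zero.2 h))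

lemma log_ss_bound {w : ℂ} (hw : ‖w‖ < 1) : ∃ B, 0 ≤ B ∧ ∀ z, ‖z‖ ≤ 1 →
    |Real.log (1 - ss w z)| ≤ |Real.log (‖z - w‖ ^ 2)| + B := by
  have : ContinuousOn (fun z => Real.log (dd w z)) (closedBall 0 1) :=
    (cont_dd w).continuousOn.log fun z hz => (dd_pos hw (by simpa using hz)).ne'
  obtain ⟨B, h0, hB⟩ := bdd_of_cont this
  refine ⟨B, h0, fun z hz => ?_⟩
  by_cases h : z = w
  · subst h
    rw [one_sub_ss hw hz]; simp [h0]
  · rw [log_one_sub_ss hw hz h]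
    exact (abs_sub _ _).trans (by gcongr; exact hB z hz)

lemma EE_bound {w : ℂ} (hw : ‖w‖ < 1) : ∃ B, 0 ≤ B ∧ ∀ z, ‖z‖ ≤ 1 →
    |EE w z| ≤ |Real.log (‖z - w‖ ^ 2)| + B := by
  obtain ⟨B1, h1, hB1⟩ := log_ss_bound hw
  obtain ⟨B2, h2, hB2⟩ := bdd_of_cont (cont_HH hw)
  refine ⟨B1 + B2, by positivity, fun z hz => ?_⟩
  unfold EE
  have := abs_sub (Real.log (1 - ss w z)) (HH w z)
  linarith [hB1 z hz, hB2 z hz]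

lemma bound_int (w : ℂ) (B K : ℝ) :
    IntegrableOn (fun z : ℂ => (|Real.log (‖z - w‖ ^ 2)| + B) * K) (ball 0 1) dSigma := by
  refine (((log_shift_int w 1).abs).add ?_).mul_const K
  exact integrableOn_const measure_ball_lt_top.ne

lemma SN_bounds {s : ℝ} (h0 : 0 ≤ s) (h1 : s < 1) (N : ℕ) :
    0 ≤ SN N s ∧ SN N s ≤ -Real.log (1 - s) := by
  have h := Real.hasSum_pow_div_log_of_abs_lt_one (x := s) (by rwa [abs_of_nonneg h0])
  refine ⟨by unfold SN; positivity, ?_⟩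
  exact sum_le_hasSum _ (fun i _ => by positivity) h

lemma SN_tendsto {s : ℝ} (h0 : 0 ≤ s) (h1 : s < 1) :
    Filter.Tendsto (fun n : ℕ => SN (n + 2) s) Filter.atTop (nhds (-Real.log (1 - s))) := by
  have h := Real.hasSum_pow_div_log_of_abs_lt_one (x := s) (by rwa [abs_of_nonneg h0])
  exact h.tendsto_sum_nat.comp (Filter.tendsto_add_atTop_nat 2)

lemma geom_bound {s : ℝ} (h0 : 0 ≤ s) (h1 : s ≤ 1) (n : ℕ) :
    (n + 2 : ℕ) * s ^ (n + 1) * (1 - s) ≤ 1 := by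
  have h2 : ((n + 2 : ℕ) : ℝ) * s ^ (n + 1) ≤ ∑ i ∈ Finset.range (n + 2), s ^ i := by
    have := Finset.card_nsmul_le_sum (Finset.range (n + 2)) (fun i => s ^ i) (s ^ (n + 1))
      (fun i hi => pow_le_pow_of_le_one h0 h1 (by have := Finset.mem_range.1 hi; omega))
    simpa using this
  have h3 := mul_neg_geom_sum s (n + 2)
  have h4 : 0 ≤ s ^ (n + 2) := by positivity
  nlinarith

lemma geom_tendsto {s : ℝ} (h0 : 0 ≤ s) (h1 : s < 1) (b : ℝ) :
    Filter.Tendsto (fun n : ℕ => ((n + 2 : ℕ) : ℝ) * s ^ (n + 1) * (1 - s) * b)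
      Filter.atTop (nhds 0) := by
  have h := (tendsto_self_mul_const_pow_of_lt_one h0 h1).comp (Filter.tendsto_add_atTop_nat 1)
  have h' := (tendsto_pow_atTop_nhds_zero_of_lt_one h0 h1).comp (Filter.tendsto_add_atTop_nat 1)
  have := ((h.add h').mul_const (1 - s)).mul_const b
  simp only [add_zero, zero_mul] at this
  refine this.congr fun n => ?_
  simp only [Function.comp]; push_cast; ring

lemma ae_ne (w : ℂ) : ∀ᵐ z ∂(dSigma.restrict (ball 0 1)), z ≠ w :=
  ae_restrict_of_ae (by simp [ae_iff])

lemma lap_ball (n : ℕ) {w : ℂ} (φ : ℂ → ℝ) :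
    ∫ x, lapR (Gam n w) x * φ x ∂dSigma = ∫ x in ball 0 1, lapR (Gam n w) x * φ x ∂dSigma := by
  rw [← setIntegral_eq_integral_of_forall_compl_eq_zero (s := closedBall 0 1)]
  · refine setIntegral_congr_set ?_
    have : ball (0:ℂ) 1 ∪ sphere 0 1 = closedBall 0 1 := ball_union_sphere
    rw [← this]
    exact (union_ae_eq_left_of_ae_eq_empty (ae_eq_empty.2 (Measure.addHaar_sphere dSigma 0 1)))
  · intro x hx
    rw [Gam_lap_out n (by simpa using hx), zero_mul]

lemma core {w : ℂ} (hw : ‖w‖ < 1) {φ : ℂ → ℝ} (hφ : ContDiff ℝ 2 φ)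
    (hsub : ∀ z, ‖z‖ < 1 → 0 ≤ lapR φ z) :
    0 ≤ ∫ z in ball 0 1, tau z * EE w z * φ z ∂dSigma := by
  have hpos : ∀ n : ℕ, 0 ≤ ∫ x in ball 0 1, lapR (Gam n w) x * φ x ∂dSigma := by
    intro n
    rw [← lap_ball, ← ibp (Gam_cd n hw) (Gam_supp n w) hφ]
    refine integral_nonneg fun z => ?_
    by_cases hz : ‖z‖ < 1
    · exact mul_nonneg (Gam_nonneg n hw z) (hsub z hz)
    · simp [Gam_zero n w (not_lt.1 hz)]
  obtain ⟨B1, h1, hB1⟩ := log_ss_bound hw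
  obtain ⟨B2, h2, hB2⟩ := bdd_of_cont (cont_HH hw)
  obtain ⟨B3, h3, hB3⟩ := bdd_of_cont (cont_av hw)
  obtain ⟨B4, h4, hB4⟩ := bdd_of_cont (cont_bv hw)
  obtain ⟨B5, h5, hB5⟩ := bdd_of_cont hφ.continuous.continuousOn
  refine ge_of_tendsto' (f := fun n : ℕ => ∫ x in ball 0 1, lapR (Gam n w) x * φ x ∂dSigma)
    (x := Filter.atTop) ?_ hpos
  refine tendsto_integral_of_dominated_convergence
    (fun z => (|Real.log (‖z - w‖ ^ 2)| + (B1 + B2 + B3 + B4)) * B5) ?_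
    (bound_int w _ _) ?_ ?_
  · intro n
    exact ((cont_lapR (Gam_cd n hw)).mul hφ.continuous).aestronglyMeasurable
  · intro n
    filter_upwards [ae_ne w, ae_restrict_mem measurableSet_ball] with z hzw hz
    have hz : ‖z‖ < 1 := by simpa using hz
    have s0 := ss_nonneg hw hz
    have s1 := ss_lt_one hw hz hzw
    have ht := tau_pos hz
    have ht1 : tau z ≤ 1 := by unfold tau; nlinarith [norm_nonneg z]
    obtain ⟨a1, a2⟩ := SN_bounds s0 s1 (n + 2)
    rw [Gam_lap_in n hw hz, Real.norm_eq_abs, abs_mul]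
    refine mul_le_mul ?_ (hB5 z hz.le) (abs_nonneg _) (by positivity)
    have e1 : |tau z * (-SN (n + 2) (ss w z) - HH w z)| ≤ |Real.log (1 - ss w z)| + B2 := by
      rw [abs_mul, abs_of_pos ht]
      have : |-SN (n + 2) (ss w z) - HH w z| ≤ |Real.log (1 - ss w z)| + B2 := by
        refine (abs_sub _ _).trans (add_le_add ?_ (hB2 z hz.le))
        rw [abs_neg, abs_of_nonneg a1]
        exact a2.trans (neg_le_abs _)
      nlinarith [abs_nonneg (-SN (n + 2) (ss w z) - HH w z)]
    have e2 : |ss w z ^ (n + 2) * av w z| ≤ B3 := by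
      rw [abs_mul, abs_of_nonneg (by positivity)]
      have := pow_le_one₀ (n := n + 2) s0 s1.le
      have h0 : 0 ≤ ss w z ^ (n + 2) := by positivity
      nlinarith [abs_nonneg (av w z), hB3 z hz.le]
    have e3 : |((n + 2 : ℕ) : ℝ) * ss w z ^ (n + 1) * (1 - ss w z) * bv w z| ≤ B4 := by
      have h0 : 0 ≤ ((n + 2 : ℕ) : ℝ) * ss w z ^ (n + 1) * (1 - ss w z) :=
        mul_nonneg (by positivity) (by linarith)
      rw [abs_mul, abs_of_nonneg h0]
      have := geom_bound s0 s1.le n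
      nlinarith [abs_nonneg (bv w z), hB4 z hz.le]
    have := abs_add_le (tau z * (-SN (n + 2) (ss w z) - HH w z) + ss w z ^ (n + 2) * av w z)
      (((n + 2 : ℕ) : ℝ) * ss w z ^ (n + 1) * (1 - ss w z) * bv w z)
    have := abs_add_le (tau z * (-SN (n + 2) (ss w z) - HH w z)) (ss w z ^ (n + 2) * av w z)
    linarith [hB1 z hz.le]
  · filter_upwards [ae_ne w, ae_restrict_mem measurableSet_ball] with z hzw hz
    have hz : ‖z‖ < 1 := by simpa using hz
    have s0 := ss_nonneg hw hz
    have s1 := ss_lt_one hw hz hzw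
    have l1 := (((SN_tendsto s0 s1).neg).sub_const (HH w z)).const_mul (tau z)
    have l2 := ((tendsto_pow_atTop_nhds_zero_of_lt_one s0 s1).comp
      (Filter.tendsto_add_atTop_nat 2)).mul_const (av w z)
    have l3 := geom_tendsto s0 s1 (bv w z)
    have := ((l1.add l2).add l3).mul_const (φ z)
    simp only [zero_mul, add_zero, neg_neg] at this
    refine (this.congr fun n => ?_)
    rw [Gam_lap_in n hw hz]; rfl

lemma core_zero {w : ℂ} (hw : ‖w‖ < 1) : ∫ z in ball 0 1, tau z * EE w z ∂dSigma = 0 := by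
  have hl : ∀ c : ℝ, ∀ z : ℂ, ‖z‖ < 1 → 0 ≤ lapR (fun _ => c) z := by
    intro c z _; rw [(Jet.const c z).lap]
  have a := core hw (φ := fun _ => 1) contDiff_const (hl 1)
  have b := core hw (φ := fun _ => -1) contDiff_const (hl (-1))
  simp only [mul_one, mul_neg, integral_neg] at a b
  linarith


lemma total_tau : ∫ z in ball (0:ℂ) 1, 2 * tau z ∂dSigma = 1 := by
  have e : ∫ z in ball (0:ℂ) 1, 2 * tau z ∂dSigma
      = ∫ z : ℂ, (fun y : ℝ => (Iio (1:ℝ)).indicator (fun y => 2 * (1 - y ^ 2)) y) ‖z‖ ∂dSigma := by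
    rw [← integral_indicator measurableSet_ball]
    refine integral_congr_ae (.of_forall fun z => ?_)
    by_cases h : ‖z‖ < 1
    · simp [indicator, h, tau]
    · simp [indicator, h]
  rw [e, integral_fun_norm_addHaar dSigma, dSigma_ball]
  simp only [Complex.finrank_real_complex, smul_eq_mul]
  have : ∫ y in Ioi (0:ℝ), y ^ (2 - 1) * (Iio (1:ℝ)).indicator (fun y => 2 * (1 - y ^ 2)) y
      = ∫ y in (0:ℝ)..1, (2 * y - 2 * y ^ 3) := by
    rw [intervalIntegral.integral_of_le zero_le_one, ← integral_Ioc_eq_integral_Ioo.symm]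
    rw [← integral_indicator measurableSet_Ioi, ← integral_indicator measurableSet_Ioo]
    refine integral_congr_ae (.of_forall fun y => ?_)
    simp only [indicator, mem_Ioi, mem_Iio, mem_Ioo]
    split_ifs <;> first | (exfalso; grind) | ring1
  rw [this, intervalIntegral.integral_sub
    (Continuous.intervalIntegrable (by fun_prop) _ _)
    (Continuous.intervalIntegrable (by fun_prop) _ _), intervalIntegral.integral_const_mul]
  simp
  norm_num

lemma int_bdd {E : Type*} [NormedAddCommGroup E] {f : ℂ → E} {K : ℝ}
    (hm : AEStronglyMeasurable f (dSigma.restrict (ball 0 1)))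
    (hb : ∀ z, ‖z‖ < 1 → ‖f z‖ ≤ K) : IntegrableOn f (ball 0 1) dSigma := by
  have h : IntegrableOn (fun _ : ℂ => K) (ball 0 1) dSigma :=
    integrableOn_const measure_ball_lt_top.ne
  refine Integrable.mono' h hm ?_
  filter_upwards [ae_restrict_mem measurableSet_ball] with z hz
  exact hb z (by simpa using hz)

lemma rot_inv (ζ : Circle) (G : ℂ → ℂ) :
    ∫ z, G (ζ * z) ∂dSigma = ∫ z, G z ∂dSigma := by
  unfold dSigma
  rw [integral_smul_measure, integral_smul_measure]
  congr 1
  have := (rotation ζ).measurePreserving.integral_comp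
    (rotation ζ).toHomeomorph.measurableEmbedding G
  simpa using this

lemma mean_tau {g : ℂ → ℂ} (hg : DifferentiableOn ℂ g (ball 0 1)) {M : ℝ}
    (hM : ∀ z, ‖z‖ < 1 → ‖g z‖ ≤ M) :
    ∫ z in ball (0:ℂ) 1, g z * ((2 * tau z : ℝ) : ℂ) ∂dSigma = g 0 := by
  set G : ℂ → ℂ := (ball (0:ℂ) 1).indicator (fun z => g z * ((2 * tau z : ℝ) : ℂ)) with hG
  have hM0 : 0 ≤ M := (norm_nonneg _).trans (hM 0 (by simp))
  have hc : ContinuousOn (fun z => g z * ((2 * tau z : ℝ) : ℂ)) (ball (0:ℂ) 1) := by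
    refine hg.continuousOn.mul (Continuous.continuousOn ?_)
    have := cd_tau.continuous
    fun_prop
  have hGm : Measurable G := by
    classical
    rw [hG, ← piecewise_eq_indicator]
    exact hc.measurable_piecewise continuousOn_const measurableSet_ball
  have hGb : ∀ z, ‖G z‖ ≤ (ball (0:ℂ) 1).indicator (fun _ => M * 2) z := by
    intro z
    by_cases hz : z ∈ ball (0:ℂ) 1
    · rw [hG, indicator_of_mem hz, indicator_of_mem hz, norm_mul]
      have hz : ‖z‖ < 1 := by simpa using hz
      have ht := tau_pos hz
      have ht1 : tau z ≤ 1 := by unfold tau; nlinarith [norm_nonneg z]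
      refine mul_le_mul (hM z hz) ?_ (norm_nonneg _) hM0
      rw [Complex.norm_real, Real.norm_eq_abs, abs_of_pos (by positivity)]
      linarith
    · rw [hG, indicator_of_notMem hz, indicator_of_notMem hz]; simp
  have hInt : Integrable (Function.uncurry fun (θ : ℝ) (z : ℂ) => G (Circle.exp θ * z))
      ((volume.restrict (Set.uIoc 0 (2 * Real.pi))).prod dSigma) := by
    have h1 : Integrable ((ball (0:ℂ) 1).indicator (fun _ => M * 2)) dSigma :=
      (integrable_indicator_iff measurableSet_ball).2 (integrableOn_const measure_ball_lt_top.ne)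
    have : IsFiniteMeasure (volume.restrict (Set.uIoc 0 (2 * Real.pi))) :=
      ⟨by rw [uIoc_of_le (by positivity), Measure.restrict_apply_univ, Real.volume_Ioc];
          exact ENNReal.ofReal_lt_top⟩
    have h2 := h1.comp_snd (volume.restrict (Set.uIoc 0 (2 * Real.pi)))
    refine h2.mono' ?_ (.of_forall fun p => ?_)
    · refine (hGm.comp ?_).aestronglyMeasurable
      have : Continuous fun a : ℝ × ℂ => ((Circle.exp a.1 : Circle) : ℂ) * a.2 := by fun_prop
      exact this.measurable
    · refine (hGb _).trans_eq ?_
      simp [indicator]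
  have hsw := MeasureTheory.intervalIntegral_integral_swap hInt
  simp only [rot_inv] at hsw
  have hinner : ∀ z : ℂ, ∫ θ in (0:ℝ)..(2 * Real.pi), G (Circle.exp θ * z)
      = (2 * Real.pi : ℝ) • ((ball (0:ℂ) 1).indicator (fun z => g 0 * ((2 * tau z : ℝ) : ℂ)) z) := by
    intro z
    by_cases hz : z ∈ ball (0:ℂ) 1
    · have hz' : ‖z‖ < 1 := by simpa using hz
      have e : ∀ θ : ℝ, G (Circle.exp θ * z)
          = g (circleMap 0 1 θ * z) * ((2 * tau z : ℝ) : ℂ) := by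
        intro θ
        have h1 : (Circle.exp θ : ℂ) * z ∈ ball (0:ℂ) 1 := by simpa using hz'
        rw [hG, indicator_of_mem h1]
        congr 2
        · simp [circleMap]
        · simp [tau]
      simp only [e]
      rw [intervalIntegral.integral_mul_const, indicator_of_mem hz]
      have hav : Real.circleAverage (fun ζ => g (ζ * z)) 0 1 = g (0 * z) := by
        refine DiffContOnCl.circleAverage ?_
        have : DifferentiableOn ℂ (fun ζ => g (ζ * z)) (closedBall 0 |1|) := by
          refine hg.comp (by fun_prop) ?_
          intro ζ hζ
          simp only [abs_one, mem_closedBall, dist_zero_right] at hζ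
          simp only [mem_ball, dist_zero_right, norm_mul]
          nlinarith [norm_nonneg z, norm_nonneg ζ]
        exact DifferentiableOn.diffContOnCl (by
          rwa [closure_ball _ (by simp)])
      rw [Real.circleAverage_def, zero_mul] at hav
      rw [← hav]
      have hp : (2 * Real.pi) ≠ 0 := by positivity
      rw [← smul_mul_assoc, smul_inv_smul₀ hp]
    · have e : ∀ θ : ℝ, G (Circle.exp θ * z) = 0 := by
        intro θ
        have h1 : (Circle.exp θ : ℂ) * z ∉ ball (0:ℂ) 1 := by simpa using hz
        rw [hG, indicator_of_notMem h1]
      simp only [e, indicator_of_notMem hz]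
      simp
  simp only [hinner] at hsw
  rw [integral_smul, intervalIntegral.integral_const, sub_zero] at hsw
  have hp : (2 * Real.pi) ≠ 0 := by positivity
  have hsw := smul_right_injective ℂ hp hsw
  rw [hG, integral_indicator measurableSet_ball, integral_indicator measurableSet_ball] at hsw
  rw [hsw, integral_const_mul, integral_complex_ofReal, total_tau]
  simp

lemma mean_tau_re {g : ℂ → ℂ} (hg : DifferentiableOn ℂ g (ball 0 1)) {M : ℝ}
    (hM : ∀ z, ‖z‖ < 1 → ‖g z‖ ≤ M) :
    ∫ z in ball (0:ℂ) 1, (g z).re * (2 * tau z) ∂dSigma = (g 0).re := by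
  rw [← mean_tau hg hM]
  have hi : Integrable (fun z => g z * ((2 * tau z : ℝ) : ℂ)) (dSigma.restrict (ball 0 1)) := by
    have hc : ContinuousOn (fun z => g z * ((2 * tau z : ℝ) : ℂ)) (ball (0:ℂ) 1) := by
      refine hg.continuousOn.mul (Continuous.continuousOn ?_)
      have := cd_tau.continuous
      fun_prop
    refine int_bdd (K := M * 2) (hc.aestronglyMeasurable measurableSet_ball) ?_
    intro z hz
    have hM0 : 0 ≤ M := (norm_nonneg _).trans (hM 0 (by simp))
    have ht := tau_pos hz
    have ht1 : tau z ≤ 1 := by unfold tau; nlinarith [norm_nonneg z]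
    rw [norm_mul]
    refine mul_le_mul (hM z hz) ?_ (norm_nonneg _) hM0
    rw [Complex.norm_real, Real.norm_eq_abs, abs_of_pos (by positivity)]
    linarith
  have := integral_re (𝕜 := ℂ) hi
  simp only [RCLike.re_eq_complex_re] at this
  rw [← this]
  refine integral_congr_ae (.of_forall fun z => ?_)
  simp only [Complex.re_mul_ofReal]


/-- The probability density attached to the reproducing kernel. -/
def nuw (ω : ℂ → ℝ) (F : ℂ → ℂ) (z : ℂ) : ℝ := ‖F z‖ ^ 2 * ω z / (F 0).re

structure Setup (ω : ℂ → ℝ) (F : ℂ → ℂ) : Prop where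
  pos : ∀ z ∈ closedDisk, 0 < ω z
  wc : ContinuousOn ω closedDisk
  Fc : ContinuousOn F closedDisk
  rep : Reproduces ω F 0

lemma Setup.sq_int {ω : ℂ → ℝ} {F : ℂ → ℂ} (S : Setup ω F) :
    ∫ z in unitDisk, ‖F z‖ ^ 2 * ω z ∂dSigma = (F 0).re ∧ (F 0).im = 0 := by
  have h := S.rep.2 F S.rep.1
  have e : ∀ z, F z * (starRingEnd ℂ) (F z) * (ω z : ℂ) = ((‖F z‖ ^ 2 * ω z : ℝ) : ℂ) := by
    intro z; rw [Complex.mul_conj, Complex.normSq_eq_norm_sq]; push_cast; ring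
  simp only [e] at h
  rw [integral_complex_ofReal] at h
  rw [← h]; simp

lemma Setup.F0_pos {ω : ℂ → ℝ} {F : ℂ → ℂ} (S : Setup ω F) : 0 < (F 0).re := by
  have hsub : ∀ z ∈ unitDisk, z ∈ closedDisk := fun z hz => ball_subset_closedBall hz
  have hm : MeasurableSet unitDisk := measurableSet_ball
  have h0 : ∀ᵐ z ∂(dSigma.restrict unitDisk), 0 ≤ ‖F z‖ ^ 2 * ω z := by
    filter_upwards [ae_restrict_mem hm] with z hz
    have := S.pos z (hsub z hz)
    positivity
  have h1 : 0 ≤ (F 0).re := by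
    rw [← S.sq_int.1]; exact integral_nonneg_of_ae h0
  refine lt_of_le_of_ne h1 fun h2 => ?_
  have h3 := S.sq_int.1
  rw [← h2, integral_eq_zero_iff_of_nonneg_ae h0 S.rep.1.2] at h3
  have h4 := S.rep.2 (fun _ => 1) ⟨by fun_prop, ?_⟩
  · have : ∫ z in unitDisk, (fun _ => (1:ℂ)) z * (starRingEnd ℂ) (F z) * (ω z : ℂ) ∂dSigma = 0 := by
      refine integral_eq_zero_of_ae ?_
      filter_upwards [h3, ae_restrict_mem hm] with z hz hzD
      have hp := S.pos z (hsub z hzD)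
      have : ‖F z‖ ^ 2 * ω z = 0 := hz
      have : F z = 0 := by
        rcases mul_eq_zero.1 this with h | h
        · simpa using h
        · exact absurd h hp.ne'
      simp [this]
    rw [this] at h4
    exact zero_ne_one h4
  · simp only [norm_one, one_pow, one_mul]
    exact (S.wc.integrableOn_compact (isCompact_closedBall _ _)).mono_set ball_subset_closedBall

lemma Setup.nu_cont {ω : ℂ → ℝ} {F : ℂ → ℂ} (S : Setup ω F) :
    ContinuousOn (nuw ω F) (closedBall 0 1) := by
  unfold nuw
  exact ((S.Fc.norm.pow 2).mul S.wc).div_const _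

lemma Setup.nu_bdd {ω : ℂ → ℝ} {F : ℂ → ℂ} (S : Setup ω F) :
    ∃ K, 0 ≤ K ∧ ∀ z, ‖z‖ ≤ 1 → |nuw ω F z| ≤ K := bdd_of_cont S.nu_cont

lemma Setup.nu_nonneg {ω : ℂ → ℝ} {F : ℂ → ℂ} (S : Setup ω F) {z : ℂ} (hz : ‖z‖ ≤ 1) :
    0 ≤ nuw ω F z := by
  have := S.pos z (by simpa [closedDisk] using hz)
  have := S.F0_pos
  unfold nuw; positivity

lemma Setup.mean_nu {ω : ℂ → ℝ} {F : ℂ → ℂ} (S : Setup ω F)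
    {g : ℂ → ℂ} (hg : DifferentiableOn ℂ g (ball 0 1)) {M : ℝ}
    (hM : ∀ z, ‖z‖ < 1 → ‖g z‖ ≤ M) :
    ∫ z in ball (0:ℂ) 1, (g z).re * nuw ω F z ∂dSigma = (g 0).re := by
  have hm : MeasurableSet unitDisk := measurableSet_ball
  have hM0 : 0 ≤ M := (norm_nonneg _).trans (hM 0 (by simp))
  have hwc : ContinuousOn ω (ball 0 1) := S.wc.mono ball_subset_closedBall
  have hFc : ContinuousOn F (ball 0 1) := S.Fc.mono ball_subset_closedBall
  obtain ⟨K, hK0, hK⟩ := bdd_of_cont (f := fun z => ‖F z‖ ^ 2 * ω z) ((S.Fc.norm.pow 2).mul S.wc)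
  have h := S.rep.2 (fun z => g z * F z) ⟨hg.mul S.rep.1.1, ?_⟩
  · have e : ∀ z, g z * F z * (starRingEnd ℂ) (F z) * (ω z : ℂ)
        = g z * ((‖F z‖ ^ 2 * ω z : ℝ) : ℂ) := by
      intro z; rw [mul_assoc (g z), Complex.mul_conj, Complex.normSq_eq_norm_sq]; push_cast; ring
    simp only [e] at h
    have hi : IntegrableOn (fun z => g z * ((‖F z‖ ^ 2 * ω z : ℝ) : ℂ)) (ball 0 1) dSigma := by
      refine int_bdd (K := M * K) (ContinuousOn.aestronglyMeasurable ?_ measurableSet_ball) ?_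
      · refine hg.continuousOn.mul ?_
        exact Complex.continuous_ofReal.comp_continuousOn ((hFc.norm.pow 2).mul hwc)
      · intro z hz
        rw [norm_mul, Complex.norm_real]
        exact mul_le_mul (hM z hz) (hK z hz.le) (norm_nonneg _) hM0
    have h2 := integral_re (𝕜 := ℂ) hi
    simp only [RCLike.re_eq_complex_re] at h2
    have h3 : ∫ z in ball (0:ℂ) 1, g z * ((‖F z‖ ^ 2 * ω z : ℝ) : ℂ) ∂dSigma = g 0 * F 0 := h
    rw [h3, Complex.mul_re, S.sq_int.2, mul_zero, sub_zero] at h2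
    have hp := S.F0_pos
    have h4 : ∀ z, (g z).re * nuw ω F z
        = (g z * ((‖F z‖ ^ 2 * ω z : ℝ) : ℂ)).re / (F 0).re := by
      intro z; rw [Complex.re_mul_ofReal, nuw]; ring
    simp only [h4]
    rw [integral_div, h2]; field_simp
  · refine int_bdd (K := M ^ 2 * K) (ContinuousOn.aestronglyMeasurable ?_ measurableSet_ball) ?_
    · exact ((hg.continuousOn.mul hFc).norm.pow 2).mul hwc
    · intro z hz
      have : ‖g z * F z‖ ^ 2 * ω z = ‖g z‖ ^ 2 * (‖F z‖ ^ 2 * ω z) := by rw [norm_mul]; ring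
      rw [this, norm_mul]
      refine mul_le_mul ?_ (hK z hz.le) (norm_nonneg _) (by positivity)
      rw [Real.norm_eq_abs, abs_of_nonneg (by positivity)]
      gcongr
      exact hM z hz

lemma log_bdd_hol {a : ℂ} (ha : ‖a‖ < 1) :
    DifferentiableOn ℂ (fun z => 2 * Complex.log (1 - a * z)) (ball 0 1) ∧
    (∃ M, ∀ z, ‖z‖ < 1 → ‖2 * Complex.log (1 - a * z)‖ ≤ M) ∧
    ∀ z, ‖z‖ < 1 → (2 * Complex.log (1 - a * z)).re = Real.log (‖1 - a * z‖ ^ 2) := by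
  have hs : ∀ z, ‖z‖ ≤ 1 → 1 - a * z ∈ Complex.slitPlane := by
    intro z hz
    refine Complex.mem_slitPlane_of_norm_lt_one (z := -(a * z)) ?_ |> fun h => by
      rwa [← sub_eq_add_neg] at h
    rw [norm_neg, norm_mul]
    nlinarith [norm_nonneg a, norm_nonneg z]
  refine ⟨?_, ?_, ?_⟩
  · intro z hz
    have hz : ‖z‖ < 1 := by simpa using hz
    refine DifferentiableAt.differentiableWithinAt ?_
    have h1 : DifferentiableAt ℂ (fun z => 1 - a * z) z := by fun_prop
    exact (h1.clog (hs z hz.le)).const_mul 2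
  · have : ContinuousOn (fun z => 2 * Complex.log (1 - a * z)) (closedBall 0 1) := by
      refine continuousOn_const.mul (ContinuousOn.clog (by fun_prop) ?_)
      intro z hz; exact hs z (by simpa using hz)
    obtain ⟨M, hM⟩ := (isCompact_closedBall (0:ℂ) 1).exists_bound_of_continuousOn this
    exact ⟨M, fun z hz => hM z (by simpa using hz.le)⟩
  · intro z hz
    rw [Real.log_pow]
    simp [Complex.log_re]

/-- Holomorphic function with real part `HH w`. -/
def hh (w z : ℂ) : ℂ := -(tau w : ℂ) * (2 * (1 - (starRingEnd ℂ) w * z)⁻¹ - 1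
  + (tau w : ℂ) / 2 * (2 * ((1 - (starRingEnd ℂ) w * z)⁻¹ * (1 - (starRingEnd ℂ) w * z)⁻¹) - 1))

lemma one_sub_ne {w z : ℂ} (hw : ‖w‖ < 1) (hz : ‖z‖ ≤ 1) : 1 - (starRingEnd ℂ) w * z ≠ 0 := by
  intro h
  have := dd_pos hw hz
  rw [dd_eq, h] at this
  simp at this

lemma hh_re {w z : ℂ} (hw : ‖w‖ < 1) (hz : ‖z‖ ≤ 1) : (hh w z).re = HH w z := by
  have hd := (dd_pos hw hz).ne'
  set t := 1 - (starRingEnd ℂ) w * z with ht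
  have hn : Complex.normSq t = dd w z := by rw [dd_eq, Complex.normSq_eq_norm_sq]
  have hre : t.re = 1 - (w.re * z.re + w.im * z.im) := by simp [ht]
  have him : t.im = -(w.re * z.im - w.im * z.re) := by simp [ht]; ring
  have h1 : (t⁻¹).re = t.re / dd w z := by rw [Complex.inv_re, hn]
  have h2 : (t⁻¹ * t⁻¹).re = (t.re ^ 2 - t.im ^ 2) / dd w z ^ 2 := by
    rw [Complex.mul_re, Complex.inv_re, Complex.inv_im, hn]; field_simp
  have e : hh w z = ((-tau w : ℝ) : ℂ) * (((2:ℝ):ℂ) * t⁻¹ - ((1:ℝ):ℂ)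
      + ((tau w / 2 : ℝ) : ℂ) * (((2:ℝ):ℂ) * (t⁻¹ * t⁻¹) - ((1:ℝ):ℂ))) := by
    simp only [hh]; rw [← ht]; push_cast; ring
  rw [e]
  simp only [Complex.re_ofReal_mul, Complex.add_re, Complex.sub_re, Complex.ofReal_re]
  rw [h1, h2, HH, hre, him]
  ring

lemma hh_hol {w : ℂ} (hw : ‖w‖ < 1) : DifferentiableOn ℂ (hh w) (ball 0 1) ∧
    ∃ M, ∀ z, ‖z‖ < 1 → ‖hh w z‖ ≤ M := by
  have hd : DifferentiableOn ℂ (hh w) (closedBall 0 1) := by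
    have h : ∀ z ∈ closedBall (0:ℂ) 1, 1 - (starRingEnd ℂ) w * z ≠ 0 :=
      fun z hz => one_sub_ne hw (by simpa using hz)
    unfold hh
    fun_prop (disch := assumption)
  refine ⟨hd.mono ball_subset_closedBall, ?_⟩
  obtain ⟨M, hM⟩ := (isCompact_closedBall (0:ℂ) 1).exists_bound_of_continuousOn hd.continuousOn
  exact ⟨M, fun z hz => hM z (by simpa using hz.le)⟩

/-- Both sides of the inequality agree on real parts of bounded holomorphic functions. -/
lemma Setup.mean_diff {ω : ℂ → ℝ} {F : ℂ → ℂ} (S : Setup ω F)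
    {g : ℂ → ℂ} (hg : DifferentiableOn ℂ g (ball 0 1)) {M : ℝ}
    (hM : ∀ z, ‖z‖ < 1 → ‖g z‖ ≤ M) :
    ∫ z in ball (0:ℂ) 1, (g z).re * (nuw ω F z - 2 * tau z) ∂dSigma = 0 := by
  have hM0 : 0 ≤ M := (norm_nonneg _).trans (hM 0 (by simp))
  have hre : ContinuousOn (fun z => (g z).re) (ball 0 1) :=
    Complex.continuous_re.comp_continuousOn hg.continuousOn
  have hb : ∀ {f : ℂ → ℝ}, ContinuousOn f (closedBall 0 1) →
      IntegrableOn (fun z => (g z).re * f z) (ball 0 1) dSigma := by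
    intro f hf
    obtain ⟨K, hK0, hK⟩ := bdd_of_cont hf
    refine int_bdd (K := M * K) (ContinuousOn.aestronglyMeasurable
      (hre.mul (hf.mono ball_subset_closedBall)) measurableSet_ball) ?_
    intro z hz
    rw [norm_mul]
    exact mul_le_mul ((Complex.abs_re_le_norm _).trans (hM z hz)) (hK z hz.le) (norm_nonneg _) hM0
  simp only [mul_sub]
  rw [integral_sub (hb S.nu_cont) (hb (f := fun z => 2 * tau z)
    (continuous_const.mul cd_tau.continuous).continuousOn), S.mean_nu hg hM, mean_tau_re hg hM, sub_self]

/-- The potential of the difference. -/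
def Phi (ω : ℂ → ℝ) (F : ℂ → ℂ) (w : ℂ) : ℝ :=
  ∫ z in ball (0:ℂ) 1, Real.log (‖z - w‖ ^ 2) * (nuw ω F z - 2 * tau z) ∂dSigma

lemma Setup.Phi_out {ω : ℂ → ℝ} {F : ℂ → ℂ} (S : Setup ω F) {w : ℂ} (hw : 1 < ‖w‖) :
    Phi ω F w = 0 := by
  have hw0 : w ≠ 0 := by intro h; rw [h] at hw; simp at hw; linarith
  have ha : ‖w⁻¹‖ < 1 := by rw [norm_inv]; exact inv_lt_one_of_one_lt₀ hw
  obtain ⟨h1, ⟨M, hM⟩, h3⟩ := log_bdd_hol ha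
  have h4 := S.mean_diff (g := fun z => ((Real.log (‖w‖ ^ 2) : ℝ) : ℂ) + 2 * Complex.log (1 - w⁻¹ * z))
    (h1.const_add _) (M := ‖((Real.log (‖w‖ ^ 2) : ℝ) : ℂ)‖ + M) (fun z hz =>
      (norm_add_le _ _).trans (by gcongr; exact hM z hz))
  rw [← h4, Phi]
  refine setIntegral_congr_fun measurableSet_ball fun z hz => ?_
  have hz : ‖z‖ < 1 := by simpa using hz
  have hne : z - w ≠ 0 := by intro h; rw [sub_eq_zero.1 h] at hz; linarith
  have e : ‖z - w‖ ^ 2 = ‖w‖ ^ 2 * ‖1 - w⁻¹ * z‖ ^ 2 := by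
    rw [← mul_pow, ← norm_mul, ← norm_neg (z - w)]
    congr 2; field_simp; ring
  have hne2 : ‖1 - w⁻¹ * z‖ ^ 2 ≠ 0 := by
    intro h; rw [h, mul_zero] at e
    exact hne (by simpa using e)
  simp only [Complex.add_re, Complex.ofReal_re]
  rw [h3 z hz, e, Real.log_mul (by positivity) hne2]

lemma Setup.Phi_in {ω : ℂ → ℝ} {F : ℂ → ℂ} (S : Setup ω F) {w : ℂ} (hw : ‖w‖ < 1)
    (hE : 0 ≤ ∫ z in ball (0:ℂ) 1, EE w z * nuw ω F z ∂dSigma) :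
    0 ≤ Phi ω F w := by
  have ha : ‖(starRingEnd ℂ) w‖ < 1 := by rwa [RCLike.norm_conj]
  obtain ⟨h1, ⟨M, hM⟩, h3⟩ := log_bdd_hol ha
  obtain ⟨h1', M', hM'⟩ := hh_hol hw
  have hgd := h1.add h1'
  have hgM : ∀ z, ‖z‖ < 1 → ‖2 * Complex.log (1 - (starRingEnd ℂ) w * z) + hh w z‖ ≤ M + M' :=
    fun z hz => (norm_add_le _ _).trans (add_le_add (hM z hz) (hM' z hz))
  have h4 := S.mean_diff hgd hgM
  obtain ⟨B, hB0, hB⟩ := EE_bound hw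
  have hb : ∀ {f : ℂ → ℝ}, ContinuousOn f (closedBall 0 1) →
      IntegrableOn (fun z => EE w z * f z) (ball 0 1) dSigma := by
    intro f hf
    obtain ⟨K, hK0, hK⟩ := bdd_of_cont hf
    refine Integrable.mono' (bound_int w B K) ((meas_EE w).aestronglyMeasurable.mul
      ((hf.mono ball_subset_closedBall).aestronglyMeasurable measurableSet_ball)) ?_
    filter_upwards [ae_restrict_mem measurableSet_ball] with z hz
    have hz : ‖z‖ < 1 := by simpa using hz
    rw [norm_mul]
    exact mul_le_mul (hB z hz.le) (hK z hz.le) (norm_nonneg _) (by positivity)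
  have hi1 := hb S.nu_cont
  have hi2 := hb (f := fun z => 2 * tau z) (continuous_const.mul cd_tau.continuous).continuousOn
  have hi3 : IntegrableOn (fun z => (2 * Complex.log (1 - (starRingEnd ℂ) w * z) + hh w z).re
      * (nuw ω F z - 2 * tau z)) (ball 0 1) dSigma := by
    have hcn := S.nu_cont.sub (f := nuw ω F) (g := fun z => 2 * tau z)
      (continuous_const.mul cd_tau.continuous).continuousOn
    obtain ⟨K, hK0, hK⟩ := bdd_of_cont hcn
    have hM0 : 0 ≤ M + M' := (norm_nonneg _).trans (hgM 0 (by simp))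
    refine int_bdd (K := (M + M') * K) (ContinuousOn.aestronglyMeasurable ?_ measurableSet_ball) ?_
    · exact (Complex.continuous_re.comp_continuousOn hgd.continuousOn).mul
        (hcn.mono ball_subset_closedBall)
    · intro z hz
      rw [norm_mul]
      exact mul_le_mul ((Complex.abs_re_le_norm _).trans (hgM z hz)) (hK z hz.le)
        (norm_nonneg _) hM0
  have hz2 : ∫ z in ball (0:ℂ) 1, EE w z * (2 * tau z) ∂dSigma = 0 := by
    have := core_zero hw
    rw [← mul_eq_zero_of_right 2 this, ← integral_const_mul]
    congr 1; ext z; ring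
  have e : Phi ω F w = ∫ z in ball (0:ℂ) 1, (EE w z * nuw ω F z - EE w z * (2 * tau z)
      + (2 * Complex.log (1 - (starRingEnd ℂ) w * z) + hh w z).re
        * (nuw ω F z - 2 * tau z)) ∂dSigma := by
    unfold Phi
    refine integral_congr_ae ?_
    filter_upwards [ae_ne w, ae_restrict_mem measurableSet_ball] with z hzw hz
    have hz : ‖z‖ < 1 := by simpa using hz
    rw [Complex.add_re, h3 z hz, hh_re hw hz.le, ← dd_eq, EE, log_one_sub_ss hw hz.le hzw]
    ring
  have hi12 : IntegrableOn (fun z => EE w z * nuw ω F z - EE w z * (2 * tau z)) (ball 0 1) dSigma :=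
    hi1.sub hi2
  rw [e, integral_add hi12 hi3, integral_sub hi1 hi2, hz2]
  have h4' : ∫ z in ball (0:ℂ) 1, (2 * Complex.log (1 - (starRingEnd ℂ) w * z) + hh w z).re
        * (nuw ω F z - 2 * tau z) ∂dSigma = 0 := h4
  rw [h4']
  linarith


lemma fderiv_re_hol {f : ℂ → ℂ} {z : ℂ} (hf : DifferentiableAt ℂ f z) (v : ℂ) :
    fderiv ℝ (fun w => (f w).re) z v = (v * deriv f z).re := by
  have h := Complex.reCLM.hasFDerivAt.comp z (hf.hasDerivAt.hasFDerivAt.restrictScalars ℝ)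
  have e : (fun w => (f w).re) = Complex.reCLM ∘ f := rfl
  rw [e, h.fderiv]
  simp

lemma fderiv_im_hol {f : ℂ → ℂ} {z : ℂ} (hf : DifferentiableAt ℂ f z) (v : ℂ) :
    fderiv ℝ (fun w => (f w).im) z v = (v * deriv f z).im := by
  have h := Complex.imCLM.hasFDerivAt.comp z (hf.hasDerivAt.hasFDerivAt.restrictScalars ℝ)
  have e : (fun w => (f w).im) = Complex.imCLM ∘ f := rfl
  rw [e, h.fderiv]
  simp

lemma jet_hol {F : ℂ → ℂ} {z : ℂ} (hF : AnalyticAt ℂ F z) :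
    Jet (fun w => (F w).re) z (deriv F z).re (-(deriv F z).im) 0 ∧
    Jet (fun w => (F w).im) z (deriv F z).im (deriv F z).re 0 := by
  have hd := hF.deriv.differentiableAt
  have hev : ∀ᶠ w in nhds z, DifferentiableAt ℂ F w :=
    hF.eventually_analyticAt.mono fun w h => h.differentiableAt
  have hcd : ContDiffAt ℝ 2 F z := hF.contDiffAt.restrict_scalars ℝ
  have e1 : ∀ v, (fun w => fderiv ℝ (fun w => (F w).re) w v) =ᶠ[nhds z]
      fun w => ((fun w => v * deriv F w) w).re := fun v => by
    filter_upwards [hev] with w hw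
    exact fderiv_re_hol hw v
  have e2 : ∀ v, (fun w => fderiv ℝ (fun w => (F w).im) w v) =ᶠ[nhds z]
      fun w => ((fun w => v * deriv F w) w).im := fun v => by
    filter_upwards [hev] with w hw
    exact fderiv_im_hol hw v
  have hd' : ∀ v : ℂ, DifferentiableAt ℂ (fun w => v * deriv F w) z := fun v => hd.const_mul v
  have hv : ∀ v : ℂ, deriv (fun w => v * deriv F w) z = v * deriv (deriv F) z := fun v =>
    deriv_const_mul v hd
  constructor
  · refine ⟨Complex.reCLM.contDiff.contDiffAt.comp z hcd, ?_, ?_, ?_⟩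
    · rw [fderiv_re_hol hF.differentiableAt]; simp
    · rw [fderiv_re_hol hF.differentiableAt]; simp
    · rw [lapR, (e1 1).fderiv_eq, (e1 I).fderiv_eq, fderiv_re_hol (hd' 1), fderiv_re_hol (hd' I),
        hv, hv, ← mul_assoc, ← mul_assoc, Complex.I_mul_I]
      simp
  · refine ⟨Complex.imCLM.contDiff.contDiffAt.comp z hcd, ?_, ?_, ?_⟩
    · rw [fderiv_im_hol hF.differentiableAt]; simp
    · rw [fderiv_im_hol hF.differentiableAt]; simp
    · rw [lapR, (e2 1).fderiv_eq, (e2 I).fderiv_eq, fderiv_im_hol (hd' 1), fderiv_im_hol (hd' I),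
        hv, hv, ← mul_assoc, ← mul_assoc, Complex.I_mul_I]
      simp

def QQ (ω : ℂ → ℝ) (F : ℂ → ℂ) (z : ℂ) : ℝ := nuw ω F z / tau z

lemma Setup.QQ_sub {ω : ℂ → ℝ} {F : ℂ → ℂ} (S : Setup ω F)
    (hω : ContDiffOn ℝ 2 ω unitDisk)
    (hsub : ∀ z ∈ unitDisk, 0 ≤ lapR (fun z => Real.log (ω z / (1 - ‖z‖ ^ 2))) z)
    {z : ℂ} (hz : ‖z‖ < 1) : ContDiffAt ℝ 2 (QQ ω F) z ∧ 0 ≤ lapR (QQ ω F) z := by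
  have hzD : z ∈ unitDisk := by simpa [unitDisk] using hz
  have hnh : unitDisk ∈ nhds z := isOpen_ball.mem_nhds hzD
  have hFan : AnalyticAt ℂ F z := S.rep.1.1.analyticAt hnh
  obtain ⟨JP, JS⟩ := jet_hol hFan
  have hwpos : ∀ x ∈ unitDisk, 0 < ω x / (1 - ‖x‖ ^ 2) := fun x hx =>
    div_pos (S.pos x (ball_subset_closedBall hx)) (tau_pos (by simpa [unitDisk] using hx))
  have hψ : ContDiffAt ℝ 2 (fun z => Real.log (ω z / (1 - ‖z‖ ^ 2))) z := by
    refine ContDiffAt.log (ContDiffAt.div (hω.contDiffAt hnh) cd_tau.contDiffAt ?_) (hwpos z hzD).ne'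
    exact (tau_pos hz).ne'
  have Jψ := jet_of_cd hψ
  have Jexp := Jet.comp (h := Real.exp) Real.contDiff_exp.contDiffAt Jψ
  simp only [Real.deriv_exp] at Jexp
  have J := (Jet.const ((F 0).re)⁻¹ z).mul (((JP.mul JP).add (JS.mul JS)).mul Jexp)
  have e : QQ ω F =ᶠ[nhds z] fun x => ((F 0).re)⁻¹ * (((F x).re * (F x).re + (F x).im * (F x).im)
      * Real.exp (Real.log (ω x / (1 - ‖x‖ ^ 2)))) := by
    filter_upwards [hnh] with x hx
    rw [Real.exp_log (hwpos x hx), ← normSq_form, QQ, nuw, tau]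
    field_simp
  refine ⟨J.cd.congr_of_eventuallyEq e, ?_⟩
  rw [lapR_congr e, J.lap]
  have h0 := hsub z hzD
  have hF0 := S.F0_pos
  generalize lapR (fun z => Real.log (ω z / (1 - ‖z‖ ^ 2))) z = L at *
  generalize fderiv ℝ (fun z => Real.log (ω z / (1 - ‖z‖ ^ 2))) z 1 = px at *
  generalize fderiv ℝ (fun z => Real.log (ω z / (1 - ‖z‖ ^ 2))) z I = py at *
  have hE := Real.exp_pos (Real.log (ω z / (1 - ‖z‖ ^ 2)))
  generalize Real.exp (Real.log (ω z / (1 - ‖z‖ ^ 2))) = E at *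
  generalize (F z).re = P at *
  generalize (F z).im = T at *
  generalize (deriv F z).re = α at *
  generalize (deriv F z).im = β at *
  have : 0 ≤ ((F 0).re)⁻¹ * (E * ((P ^ 2 + T ^ 2) * L + (α + (P * px + T * py) / 2) ^ 2
    + (β + (T * px - P * py) / 2) ^ 2)) := by positivity
  refine this.trans_eq ?_
  ring

lemma dilate {u : ℂ → ℝ} (hu : ∀ z, ‖z‖ < 1 → ContDiffAt ℝ 2 u z) {r : ℝ} (h0 : 0 < r)
    (h1 : r < 1) : ∃ φ : ℂ → ℝ, ContDiff ℝ 2 φ ∧ HasCompactSupport φ ∧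
      (∀ z, ‖z‖ ≤ 1 → φ z = u (r * z)) ∧
      ∀ z, ‖z‖ ≤ 1 → lapR φ z = r ^ 2 * lapR u (r * z) := by
  have hr : 1 < r⁻¹ := (one_lt_inv₀ h0).2 h1
  obtain ⟨R1, hR1, hR1'⟩ := exists_between hr
  obtain ⟨R2, hR2, hR2'⟩ := exists_between hR1'
  let f : ContDiffBump (0:ℂ) := ⟨R1, R2, by linarith, hR2⟩
  have heq : ∀ z : ℂ, ‖z‖ < R1 → (fun z => f z * u (r * z)) z = u (r * z) := by
    intro z hz
    have : f z = 1 := f.one_of_mem_closedBall (by simpa using hz.le)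
    simp [this]
  have hev : ∀ z : ℂ, ‖z‖ ≤ 1 → (fun z => f z * u (r * z)) =ᶠ[nhds z] fun z => u (r * z) := by
    intro z hz
    have : {x : ℂ | ‖x‖ < R1} ∈ nhds z :=
      (isOpen_lt continuous_norm continuous_const).mem_nhds (lt_of_le_of_lt hz hR1)
    filter_upwards [this] with x hx using heq x hx
  refine ⟨fun z => f z * u (r * z), ?_, ?_, fun z hz => heq z (by linarith), ?_⟩
  · rw [contDiff_iff_contDiffAt]
    intro z
    by_cases hz : ‖z‖ < r⁻¹
    · refine f.contDiff.contDiffAt.mul ?_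
      have h2 : ‖(r:ℂ) * z‖ < 1 := by
        rw [norm_mul, Complex.norm_real, Real.norm_eq_abs, abs_of_pos h0]
        calc r * ‖z‖ < r * r⁻¹ := by gcongr
          _ = 1 := mul_inv_cancel₀ h0.ne'
      exact (hu _ h2).comp z (contDiffAt_const.mul contDiffAt_id)
    · have : {x : ℂ | R2 < ‖x‖} ∈ nhds z :=
        (isOpen_lt continuous_const continuous_norm).mem_nhds (lt_of_lt_of_le hR2' (not_lt.1 hz))
      refine contDiffAt_const (c := (0:ℝ)) |>.congr_of_eventuallyEq ?_
      filter_upwards [this] with x hx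
      have : f x = 0 := f.zero_of_le_dist (by simpa using (le_of_lt hx))
      simp [this]
  · exact f.hasCompactSupport.mul_right
  · intro z hz
    rw [lapR_congr (hev z hz), lapR_comp_smul]

/-- Radii increasing to one. -/
def rn (n : ℕ) : ℝ := 1 - 1 / ((n : ℝ) + 2)

lemma rn_pos (n : ℕ) : 0 < rn n := by
  unfold rn
  rw [sub_pos, div_lt_one (by positivity)]
  linarith [Nat.cast_nonneg (α := ℝ) n]

lemma rn_lt (n : ℕ) : rn n < 1 := by
  unfold rn
  have : 0 < 1 / ((n : ℝ) + 2) := by positivity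
  linarith

lemma rn_tendsto : Filter.Tendsto rn Filter.atTop (nhds 1) := by
  have h := (tendsto_one_div_add_atTop_nhds_zero_nat (𝕜 := ℝ)).comp (Filter.tendsto_add_atTop_nat 1)
  have := h.const_sub 1
  rw [sub_zero] at this
  refine this.congr fun n => ?_
  simp only [Function.comp, rn]; push_cast; ring

lemma rn_mul_tendsto (z : ℂ) : Filter.Tendsto (fun n => (rn n : ℂ) * z) Filter.atTop (nhds z) := by
  have : Filter.Tendsto (fun n => ((rn n : ℝ) : ℂ)) Filter.atTop (nhds ((1:ℝ):ℂ)) :=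
    (Complex.continuous_ofReal.tendsto 1).comp rn_tendsto
  simpa using this.mul_const z

lemma rn_norm (n : ℕ) (z : ℂ) : ‖(rn n : ℂ) * z‖ ≤ ‖z‖ := by
  rw [norm_mul, Complex.norm_real, Real.norm_eq_abs, abs_of_pos (rn_pos n)]
  nlinarith [rn_lt n, norm_nonneg z]

lemma Setup.EE_nu {ω : ℂ → ℝ} {F : ℂ → ℂ} (S : Setup ω F)
    (hω : ContDiffOn ℝ 2 ω unitDisk)
    (hsub : ∀ z ∈ unitDisk, 0 ≤ lapR (fun z => Real.log (ω z / (1 - ‖z‖ ^ 2))) z)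
    {w : ℂ} (hw : ‖w‖ < 1) : 0 ≤ ∫ z in ball (0:ℂ) 1, EE w z * nuw ω F z ∂dSigma := by
  have hQ := fun z hz => S.QQ_sub hω hsub (z := z) hz
  choose φ h1 h2 h3 h4 using fun n => dilate (fun z hz => (hQ z hz).1) (rn_pos n) (rn_lt n)
  have hpos : ∀ n : ℕ, 0 ≤ ∫ z in ball 0 1, tau z * EE w z * φ n z ∂dSigma := by
    intro n
    refine core hw (h1 n) fun z hz => ?_
    rw [h4 n z hz.le]
    have := (hQ _ ((rn_norm n z).trans_lt hz)).2
    positivity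
  obtain ⟨B, hB0, hB⟩ := EE_bound hw
  obtain ⟨K, hK0, hK⟩ := S.nu_bdd
  refine ge_of_tendsto' (f := fun n : ℕ => ∫ z in ball 0 1, tau z * EE w z * φ n z ∂dSigma)
    (x := Filter.atTop) ?_ hpos
  refine tendsto_integral_of_dominated_convergence
    (fun z => (|Real.log (‖z - w‖ ^ 2)| + B) * K) ?_ (bound_int w _ _) ?_ ?_
  · intro n
    exact ((meas_tau.mul (meas_EE w)).mul (h1 n).continuous.measurable).aestronglyMeasurable
  · intro n
    filter_upwards [ae_restrict_mem measurableSet_ball] with z hz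
    have hz : ‖z‖ < 1 := by simpa using hz
    rw [h3 n z hz.le, mul_comm (tau z), mul_assoc, norm_mul]
    refine mul_le_mul (hB z hz.le) ?_ (norm_nonneg _) (by positivity)
    have hn := rn_norm n z
    have hz' := hn.trans_lt hz
    have ht := tau_pos hz'
    have htz := tau_pos hz
    have hle : tau z ≤ tau (rn n * z) := by
      unfold tau; nlinarith [norm_nonneg z, norm_nonneg ((rn n : ℂ) * z)]
    have hnn := S.nu_nonneg hz'.le
    rw [QQ, Real.norm_eq_abs, abs_of_nonneg (by positivity)]
    refine le_trans ?_ ((le_abs_self _).trans (hK _ hz'.le))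
    rw [mul_div_assoc', div_le_iff₀ ht]
    nlinarith
  · filter_upwards [ae_restrict_mem measurableSet_ball] with z hz
    have hz : ‖z‖ < 1 := by simpa using hz
    have hc := (hQ z hz).1.continuousAt.tendsto.comp (rn_mul_tendsto z)
    have := hc.const_mul (tau z * EE w z)
    have e : tau z * EE w z * QQ ω F z = EE w z * nuw ω F z := by
      have := (tau_pos hz).ne'
      rw [QQ]; field_simp
    rw [e] at this
    refine this.congr fun n => ?_
    rw [h3 n z hz.le]; rfl


lemma fubini_potential {c φ : ℂ → ℝ} (hcm : Measurable c) {K : ℝ} (hcb : ∀ z, |c z| ≤ K)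
    (hc0 : ∀ z, z ∉ ball (0:ℂ) 1 → c z = 0) (hφ : ContDiff ℝ 2 φ) (hs : HasCompactSupport φ) :
    ∫ z, c z * φ z ∂dSigma
      = ∫ w, lapR φ w * (∫ z, Real.log (‖z - w‖ ^ 2) * c z ∂dSigma) ∂dSigma := by
  have hK0 : 0 ≤ K := (abs_nonneg _).trans (hcb 0)
  have hlc := cont_lapR hφ
  have hls := supp_lapR hs
  obtain ⟨A, hA⟩ := hlc.bounded_above_of_compact_support hls
  have hA0 : 0 ≤ A := (norm_nonneg _).trans (hA 0)
  obtain ⟨R, hR⟩ := hls.isCompact.isBounded.subset_ball (0:ℂ)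
  have hl0 : ∀ w, w ∉ ball (0:ℂ) R → lapR φ w = 0 := fun w hw =>
    image_eq_zero_of_notMem_tsupport fun h => hw (hR h)
  have hInt : Integrable (Function.uncurry fun (z w : ℂ) =>
      lapR φ w * (Real.log (‖z - w‖ ^ 2) * c z)) (dSigma.prod dSigma) := by
    have i1 : Integrable ((ball (0:ℂ) R).indicator fun _ => A * K) dSigma :=
      (integrable_indicator_iff measurableSet_ball).2 (integrableOn_const measure_ball_lt_top.ne)
    have i2 : Integrable ((ball (0:ℂ) (R + 1)).indicator fun v : ℂ => |Real.log (‖v‖ ^ 2)|) dSigma :=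
      (integrable_indicator_iff measurableSet_ball).2 (log_integrableOn _).abs
    have i3 := i1.convolution_integrand (ContinuousLinearMap.mul ℝ ℝ) i2
    refine i3.mono' ?_ (.of_forall fun p => ?_)
    · refine Measurable.aestronglyMeasurable ?_
      have := hlc.measurable
      simp only [Function.uncurry_def]
      fun_prop
    · obtain ⟨z, w⟩ := p
      simp only [Function.uncurry, ContinuousLinearMap.mul_apply']
      have hnn : 0 ≤ (ball (0:ℂ) R).indicator (fun _ => A * K) w
          * (ball (0:ℂ) (R + 1)).indicator (fun v : ℂ => |Real.log (‖v‖ ^ 2)|) (z - w) :=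
        mul_nonneg (indicator_nonneg (fun _ _ => by positivity) _)
          (indicator_nonneg (fun _ _ => abs_nonneg _) _)
      by_cases hw : w ∈ ball (0:ℂ) R
      · by_cases hz : z ∈ ball (0:ℂ) 1
        · have hzw : z - w ∈ ball (0:ℂ) (R + 1) := by
            simp only [mem_ball, dist_zero_right] at hw hz ⊢
            linarith [norm_sub_le z w]
          rw [indicator_of_mem hw, indicator_of_mem hzw, norm_mul, norm_mul]
          have e1 := hA w
          have e2 := hcb z
          have e3 : 0 ≤ ‖Real.log (‖z - w‖ ^ 2)‖ := norm_nonneg _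
          calc ‖lapR φ w‖ * (‖Real.log (‖z - w‖ ^ 2)‖ * ‖c z‖)
              ≤ A * (‖Real.log (‖z - w‖ ^ 2)‖ * K) := by gcongr; exact e2
            _ = A * K * |Real.log (‖z - w‖ ^ 2)| := by rw [Real.norm_eq_abs]; ring
        · rw [hc0 z hz]; simpa using hnn
      · rw [hl0 w hw]; simpa using hnn
  have hsw := integral_integral_swap hInt
  calc ∫ z, c z * φ z ∂dSigma
      = ∫ z, ∫ w, lapR φ w * (Real.log (‖z - w‖ ^ 2) * c z) ∂dSigma ∂dSigma := by
        congr 1; ext z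
        rw [← fund hφ hs z, ← integral_const_mul]
        congr 1; ext w; ring
    _ = ∫ w, ∫ z, lapR φ w * (Real.log (‖z - w‖ ^ 2) * c z) ∂dSigma ∂dSigma := hsw
    _ = _ := by
        congr 1; ext w
        rw [integral_const_mul]

lemma Setup.smooth_case {ω : ℂ → ℝ} {F : ℂ → ℂ} (S : Setup ω F)
    (hω : ContDiffOn ℝ 2 ω unitDisk)
    (hsub : ∀ z ∈ unitDisk, 0 ≤ lapR (fun z => Real.log (ω z / (1 - ‖z‖ ^ 2))) z)
    {φ : ℂ → ℝ} (hφ : ContDiff ℝ 2 φ) (hs : HasCompactSupport φ)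
    (hl : ∀ z, ‖z‖ < 1 → 0 ≤ lapR φ z) :
    0 ≤ ∫ z in ball (0:ℂ) 1, φ z * (nuw ω F z - 2 * tau z) ∂dSigma := by
  have hcn := S.nu_cont.sub (f := nuw ω F) (g := fun z => 2 * tau z)
      (continuous_const.mul cd_tau.continuous).continuousOn
  obtain ⟨K, hK0, hK⟩ := bdd_of_cont hcn
  set c : ℂ → ℝ := (ball (0:ℂ) 1).indicator (fun z => nuw ω F z - 2 * tau z) with hc
  have hcm : Measurable c := by
    classical
    rw [hc, ← piecewise_eq_indicator]
    exact (hcn.mono ball_subset_closedBall).measurable_piecewise continuousOn_const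
      measurableSet_ball
  have hcb : ∀ z, |c z| ≤ K := by
    intro z
    by_cases hz : z ∈ ball (0:ℂ) 1
    · rw [hc, indicator_of_mem hz]
      have hz' : ‖z‖ < 1 := by simpa using hz
      exact hK z hz'.le
    · rw [hc, indicator_of_notMem hz]; simpa using hK0
  have hfub := fubini_potential hcm hcb (fun z hz => by rw [hc, indicator_of_notMem hz]) hφ hs
  have e1 : ∫ z in ball (0:ℂ) 1, φ z * (nuw ω F z - 2 * tau z) ∂dSigma
      = ∫ z, c z * φ z ∂dSigma := by
    rw [← integral_indicator measurableSet_ball]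
    congr 1; ext z
    by_cases hz : z ∈ ball (0:ℂ) 1
    · rw [hc, indicator_of_mem hz, indicator_of_mem hz]; ring
    · rw [hc, indicator_of_notMem hz, indicator_of_notMem hz]; ring
  have e2 : ∀ w, ∫ z, Real.log (‖z - w‖ ^ 2) * c z ∂dSigma = Phi ω F w := by
    intro w
    rw [Phi, ← integral_indicator measurableSet_ball]
    congr 1; ext z
    by_cases hz : z ∈ ball (0:ℂ) 1
    · rw [hc, indicator_of_mem hz, indicator_of_mem hz]
    · rw [hc, indicator_of_notMem hz, indicator_of_notMem hz]; ring
  rw [e1, hfub]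
  simp only [e2]
  refine integral_nonneg_of_ae ?_
  have hsph : ∀ᵐ w ∂dSigma, w ∉ sphere (0:ℂ) 1 :=
    measure_eq_zero_iff_ae_notMem.1 (Measure.addHaar_sphere dSigma 0 1)
  filter_upwards [hsph] with w hw
  have hw : ‖w‖ ≠ 1 := by simpa using hw
  rcases lt_or_gt_of_ne hw with h | h
  · exact mul_nonneg (hl w h) (S.Phi_in h (S.EE_nu hω hsub h))
  · simp [S.Phi_out h]

lemma growth_int {β : ℝ} (hβ : β < 1) :
    IntegrableOn (fun z : ℂ => (1 - ‖z‖) ^ (-β)) (ball 0 1) dSigma := by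
  rw [integrableOn_fun_norm_addHaar dSigma (f := fun y : ℝ => (1 - y) ^ (-β))]
  have h : IntervalIntegrable (fun x : ℝ => x ^ (-β)) volume 1 0 :=
    intervalIntegral.intervalIntegrable_rpow' (by linarith)
  have h2 := h.comp_sub_left 1
  simp only [sub_self, sub_zero] at h2
  rw [intervalIntegrable_iff_integrableOn_Ioo_of_le zero_le_one] at h2
  simp only [Complex.finrank_real_complex, smul_eq_mul]
  refine Integrable.mono' h2 ?_ ?_
  · exact Measurable.aestronglyMeasurable (by fun_prop)
  · filter_upwards [ae_restrict_mem measurableSet_Ioo] with y hy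
    have : 0 ≤ (1 - y) ^ (-β) := Real.rpow_nonneg (by linarith [hy.2]) _
    rw [Real.norm_eq_abs, abs_of_nonneg (mul_nonneg (by have := hy.1; positivity) this)]
    have h1 : y ^ (2 - 1) ≤ 1 := by simpa using hy.2.le
    nlinarith

lemma main_ineq {ω : ℂ → ℝ} {F : ℂ → ℂ} (S : Setup ω F)
    (hω : ContDiffOn ℝ 2 ω unitDisk)
    (hsub : ∀ z ∈ unitDisk, 0 ≤ lapR (fun z => Real.log (ω z / (1 - ‖z‖ ^ 2))) z)
    (u : ℂ → ℝ) (hu : ContDiffOn ℝ 2 u unitDisk)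
    (husub : ∀ z ∈ unitDisk, 0 ≤ lapR u z)
    (β C : ℝ) (hβ0 : 0 < β) (hβ1 : β < 1)
    (hgrowth : ∀ z ∈ unitDisk, |u z| ≤ C * (1 - ‖z‖) ^ (-β)) :
    ∫ z in ball (0:ℂ) 1, u z * (2 * tau z) ∂dSigma ≤
      ∫ z in ball (0:ℂ) 1, u z * nuw ω F z ∂dSigma := by
  have hmem : ∀ z : ℂ, ‖z‖ < 1 → z ∈ unitDisk := fun z hz => by simpa [unitDisk] using hz
  have hcd : ∀ z : ℂ, ‖z‖ < 1 → ContDiffAt ℝ 2 u z := fun z hz =>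
    hu.contDiffAt (isOpen_ball.mem_nhds (hmem z hz))
  have hC : 0 ≤ C := by
    have := hgrowth 0 (hmem 0 (by simp))
    simp only [norm_zero, sub_zero, Real.one_rpow, mul_one] at this
    exact (abs_nonneg _).trans this
  have hgi : ∀ K : ℝ, IntegrableOn (fun z : ℂ => C * (1 - ‖z‖) ^ (-β) * K) (ball 0 1) dSigma :=
    fun K => ((growth_int hβ1).const_mul C).mul_const K
  have huc : ContinuousOn u (ball 0 1) := hu.continuousOn
  have hb : ∀ {f : ℂ → ℝ}, ContinuousOn f (closedBall 0 1) →
      IntegrableOn (fun z => u z * f z) (ball 0 1) dSigma := by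
    intro f hf
    obtain ⟨K, hK0, hK⟩ := bdd_of_cont hf
    refine Integrable.mono' (hgi K) ((huc.mul (hf.mono
      ball_subset_closedBall)).aestronglyMeasurable measurableSet_ball) ?_
    filter_upwards [ae_restrict_mem measurableSet_ball] with z hz
    have hz' : ‖z‖ < 1 := by simpa using hz
    rw [norm_mul]
    exact mul_le_mul (hgrowth z hz) (hK z hz'.le) (norm_nonneg _)
      ((abs_nonneg _).trans (hgrowth z hz))
  have hi1 := hb S.nu_cont
  have hi2 := hb (f := fun z => 2 * tau z) (continuous_const.mul cd_tau.continuous).continuousOn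
  have hcn := S.nu_cont.sub (f := nuw ω F) (g := fun z => 2 * tau z)
      (continuous_const.mul cd_tau.continuous).continuousOn
  rw [← sub_nonneg, ← integral_sub hi1 hi2]
  simp only [← mul_sub]
  choose φ h1 h2 h3 h4 using fun n => dilate hcd (rn_pos n) (rn_lt n)
  obtain ⟨K, hK0, hK⟩ := bdd_of_cont hcn
  refine ge_of_tendsto' (f := fun n : ℕ => ∫ z in ball (0:ℂ) 1,
    φ n z * (nuw ω F z - 2 * tau z) ∂dSigma) (x := Filter.atTop) ?_ ?_
  · refine tendsto_integral_of_dominated_convergence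
      (fun z => C * (1 - ‖z‖) ^ (-β) * K) ?_ (hgi K) ?_ ?_
    · intro n
      exact ((h1 n).continuous.continuousOn.mul (hcn.mono
        ball_subset_closedBall)).aestronglyMeasurable measurableSet_ball
    · intro n
      filter_upwards [ae_restrict_mem measurableSet_ball] with z hz
      have hz' : ‖z‖ < 1 := by simpa using hz
      have hn := rn_norm n z
      have hg := hgrowth _ (hmem _ (hn.trans_lt hz'))
      have hle : (1 - ‖(rn n : ℂ) * z‖) ^ (-β) ≤ (1 - ‖z‖) ^ (-β) :=
        Real.rpow_le_rpow_of_nonpos (by linarith) (by linarith) (by linarith)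
      rw [norm_mul, h3 n z hz'.le]
      refine mul_le_mul (hg.trans (by gcongr)) (hK z hz'.le) (norm_nonneg _)
        ((abs_nonneg _).trans (hgrowth z hz))
    · filter_upwards [ae_restrict_mem measurableSet_ball] with z hz
      have hz' : ‖z‖ < 1 := by simpa using hz
      have hc := (hcd z hz').continuousAt.tendsto.comp (rn_mul_tendsto z)
      refine (hc.mul_const (nuw ω F z - 2 * tau z)).congr fun n => ?_
      rw [h3 n z hz'.le]; rfl
  · intro n
    refine S.smooth_case hω hsub (h1 n) (h2 n) fun z hz => ?_
    rw [h4 n z hz.le]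
    have := husub _ (hmem _ ((rn_norm n z).trans_lt hz))
    positivity

/-- Λ_ω is an expansive multiplier on C²-smooth subharmonic
functions with moderate boundary growth, when log(ω(z)/(1-|z|²)) is subharmonic. -/
theorem statement9 (ω : ℂ → ℝ) (F : ℂ → ℂ) (Λ : ℂ → ℝ)
    (hωpos : ∀ z ∈ closedDisk, 0 < ω z)
    (hωsmooth : ContDiffOn ℝ (⊤ : ℕ∞) ω closedDisk)
    (hsub : ∀ z ∈ unitDisk, 0 ≤ lapR (fun z => Real.log (ω z / (1 - ‖z‖ ^ 2))) z)
    (hFsmooth : ContDiffOn ℝ (⊤ : ℕ∞) F closedDisk)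
    (hF : Reproduces ω F 0)
    (hΛ : ∀ z : ℂ, Λ z = ‖F z‖ ^ 2 / (F 0).re * (ω z / (2 * (1 - ‖z‖ ^ 2))))
    (u : ℂ → ℝ) (hu : ContDiffOn ℝ 2 u unitDisk)
    (husub : ∀ z ∈ unitDisk, 0 ≤ lapR u z)
    (β C : ℝ) (hβ0 : 0 < β) (hβ1 : β < 1)
    (hgrowth : ∀ z ∈ unitDisk, |u z| ≤ C * (1 - ‖z‖) ^ (-β)) :
    ∫ z in unitDisk, u z * (2 * (1 - ‖z‖ ^ 2)) ∂dSigma ≤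
      ∫ z in unitDisk, Λ z * u z * (2 * (1 - ‖z‖ ^ 2)) ∂dSigma := by
  have S : Setup ω F := ⟨hωpos, hωsmooth.continuousOn, hFsmooth.continuousOn, hF⟩
  have hω2 : ContDiffOn ℝ 2 ω unitDisk :=
    (hωsmooth.mono ball_subset_closedBall).of_le
      (WithTop.coe_le_coe.2 (le_top : (2 : ℕ∞) ≤ ⊤))
  have h := main_ineq S hω2 hsub u hu husub β C hβ0 hβ1 hgrowth
  have hF0 := S.F0_pos
  have e : ∫ z in unitDisk, Λ z * u z * (2 * (1 - ‖z‖ ^ 2)) ∂dSigma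
      = ∫ z in ball (0:ℂ) 1, u z * nuw ω F z ∂dSigma := by
    refine setIntegral_congr_fun measurableSet_ball fun z hz => ?_
    have hz1 : ‖z‖ < 1 := by simpa [unitDisk] using hz
    have ht : (1 - ‖z‖ ^ 2) ≠ 0 := by
      have := norm_nonneg z
      nlinarith
    have hF0n := hF0.ne'
    simp only [hΛ, nuw]
    field_simp
  rw [e]
  exact h

end
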